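/- Let G ∈ G(n,p) with log⁵ n ≪ d = p(n−1) ≤ n(1 − 3 log log n / log n). Let i ≥ 0 be the largest integer such that d^i = o(n), let c = d^{i+1}/n, and let q = (e^{−c})² + (1 − e^{−c})² if p = o(1) and q = p² + (1−p)² if p = Θ(1). If c → ∞ and e^c ≤ (log n)/(3 log log n), then asymptotically almost surely β(G) = (1 + o(1)) · 2 log n / log(1/q) = (1 + o(1)) e^c log n, and in particular β(G) ≫ log n. -/

import Mathlib

open Filter Real Asymptotics
open scoped Topology

/-- `R` is a resolving set of the graph `G`: every pair of distinct vertices is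
distinguished by its distances to some vertex of `R`. -/
def Resolves {V : Type*} (G : SimpleGraph V) (R : Set V) : Prop :=
  ∀ ⦃v w : V⦄, v ≠ w → ∃ u ∈ R, G.dist u v ≠ G.dist u w

/-- The metric dimension of a graph `G`: the smallest cardinality of a resolving set. -/
noncomputable def metricDim {V : Type*} (G : SimpleGraph V) : ℕ :=
  sInf {k : ℕ | ∃ R : Set V, R.Finite ∧ R.ncard = k ∧ Resolves G R}

/-- The `G(n,p)` probability weight of a single graph on `Fin n`. -/
noncomputable def gnpWeight (n : ℕ) (p : ℝ) (G : SimpleGraph (Fin n)) : ℝ :=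
  p ^ Nat.card G.edgeSet * (1 - p) ^ (n.choose 2 - Nat.card G.edgeSet)

/-- The probability of an event `A` under the binomial random graph `G(n,p)`. -/
noncomputable def gnpProb (n : ℕ) (p : ℝ) (A : Set (SimpleGraph (Fin n))) : ℝ :=
  ∑' G : SimpleGraph (Fin n), A.indicator (gnpWeight n p) G

/-- `S(v,i)`: the set of vertices at graph distance exactly `i` from `v`. -/
def gSphere {V : Type*} (G : SimpleGraph V) (v : V) (i : ℕ) : Set V :=
  {u | G.Reachable v u ∧ G.dist v u = i}

/-- `N(v,i)`: the set of vertices at graph distance at most `i` from `v`. -/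
def gBall {V : Type*} (G : SimpleGraph V) (v : V) (i : ℕ) : Set V :=
  {u | G.Reachable v u ∧ G.dist v u ≤ i}

/-- `S(V',i)`: union of the spheres around the vertices of `V'`. -/
def gSphereSet {V : Type*} (G : SimpleGraph V) (W : Set V) (i : ℕ) : Set V :=
  ⋃ v ∈ W, gSphere G v i

/-- `N(V',i)`: union of the balls around the vertices of `V'`. -/
def gBallSet {V : Type*} (G : SimpleGraph V) (W : Set V) (i : ℕ) : Set V :=
  ⋃ v ∈ W, gBall G v i

section BinomialSubset

open Classical in
/-- Expectation of `f` over the random subset of `A` containing each element independently with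
probability `p`. -/
noncomputable def binomExp {α : Type*} (p : ℝ) (A : Finset α) (f : Finset α → ℝ) : ℝ :=
  ∑ S ∈ A.powerset, p ^ S.card * (1 - p) ^ (A.card - S.card) * f S

variable {α β : Type*} {p : ℝ}

theorem binomExp_congr {A : Finset α} {f g : Finset α → ℝ} (h : ∀ S ⊆ A, f S = g S) :
    binomExp p A f = binomExp p A g := by
  unfold binomExp
  refine Finset.sum_congr rfl fun S hS => ?_
  rw [h S (Finset.mem_powerset.1 hS)]

theorem binomExp_mono (h0 : 0 ≤ p) (h1 : p ≤ 1) {A : Finset α} {f g : Finset α → ℝ}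
    (h : ∀ S ⊆ A, f S ≤ g S) : binomExp p A f ≤ binomExp p A g := by
  unfold binomExp
  have : 0 ≤ 1 - p := by linarith
  refine Finset.sum_le_sum fun S hS => ?_
  exact mul_le_mul_of_nonneg_left (h S (Finset.mem_powerset.1 hS)) (by positivity)

theorem binomExp_const (A : Finset α) (a : ℝ) : binomExp p A (fun _ => a) = a := by
  unfold binomExp
  rw [← Finset.sum_mul, Finset.sum_pow_mul_eq_add_pow]
  simp

theorem binomExp_const_mul (A : Finset α) (a : ℝ) (f : Finset α → ℝ) :
    binomExp p A (fun S => a * f S) = a * binomExp p A f := by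
  unfold binomExp
  rw [Finset.mul_sum]
  exact Finset.sum_congr rfl fun S _ => by ring

theorem binomExp_mul_const (A : Finset α) (a : ℝ) (f : Finset α → ℝ) :
    binomExp p A (fun S => f S * a) = binomExp p A f * a := by
  simp_rw [mul_comm _ a]
  exact binomExp_const_mul A a f

theorem binomExp_add (A : Finset α) (f g : Finset α → ℝ) :
    binomExp p A (fun S => f S + g S) = binomExp p A f + binomExp p A g := by
  unfold binomExp
  rw [← Finset.sum_add_distrib]
  exact Finset.sum_congr rfl fun S _ => by ring

theorem binomExp_sum {ι : Type*} (A : Finset α) (I : Finset ι) (f : ι → Finset α → ℝ) :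
    binomExp p A (fun S => ∑ j ∈ I, f j S) = ∑ j ∈ I, binomExp p A (f j) := by
  unfold binomExp
  rw [Finset.sum_comm]
  exact Finset.sum_congr rfl fun S _ => by rw [Finset.mul_sum]

theorem binomExp_empty (f : Finset α → ℝ) : binomExp p ∅ f = f ∅ := by
  simp [binomExp]

theorem binomExp_nonneg (h0 : 0 ≤ p) (h1 : p ≤ 1) {A : Finset α} {f : Finset α → ℝ}
    (h : ∀ S ⊆ A, 0 ≤ f S) : 0 ≤ binomExp p A f := by
  rw [← binomExp_const (p := p) A 0]
  exact binomExp_mono h0 h1 h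

variable [DecidableEq α] [DecidableEq β]

theorem binomExp_insert {A : Finset α} {a : α} (ha : a ∉ A) (f : Finset α → ℝ) :
    binomExp p (insert a A) f =
      (1 - p) * binomExp p A f + p * binomExp p A (fun S => f (insert a S)) := by
  unfold binomExp
  rw [Finset.sum_powerset_insert ha, Finset.mul_sum, Finset.mul_sum]
  congr 1
  · refine Finset.sum_congr rfl fun S hS => ?_
    have := Finset.card_le_card (Finset.mem_powerset.1 hS)
    rw [Finset.card_insert_of_notMem ha, Nat.sub_add_comm this, pow_succ]
    ring
  · refine Finset.sum_congr rfl fun S hS => ?_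
    have h := Finset.mem_powerset.1 hS
    rw [Finset.card_insert_of_notMem ha, Finset.card_insert_of_notMem fun h' => ha (h h'),
      Nat.add_sub_add_right, pow_succ]
    ring

theorem binomExp_union {A B : Finset α} (h : Disjoint A B) (f : Finset α → ℝ) :
    binomExp p (A ∪ B) f = binomExp p A fun S => binomExp p B fun S' => f (S ∪ S') := by
  induction A using Finset.induction_on generalizing f with
  | empty => simp [binomExp_empty]
  | insert a A ha ih =>
    rw [Finset.disjoint_insert_left] at h
    have ha' : a ∉ A ∪ B := by simp [ha, h.1]
    rw [Finset.insert_union, binomExp_insert ha', ih h.2, ih h.2, binomExp_insert ha]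
    simp only [Finset.insert_union]

theorem binomExp_image {A : Finset α} {φ : α → β} (hφ : Set.InjOn φ A) (f : Finset β → ℝ) :
    binomExp p (A.image φ) f = binomExp p A fun S => f (S.image φ) := by
  induction A using Finset.induction_on generalizing f with
  | empty => simp [binomExp_empty]
  | insert a A ha ih =>
    have h1 : Set.InjOn φ A := hφ.mono (by simp)
    have ha' : φ a ∉ A.image φ := by
      intro hm
      obtain ⟨b, hb, hab⟩ := Finset.mem_image.1 hm
      have := hφ (by simp [hb]) (by simp) hab
      exact ha (this ▸ hb)
    rw [Finset.image_insert, binomExp_insert ha', ih h1, ih h1, binomExp_insert ha]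
    simp only [Finset.image_insert]

theorem binomExp_eq_empty (A : Finset α) :
    binomExp p A (fun S => if S = ∅ then 1 else 0) = (1 - p) ^ A.card := by
  induction A using Finset.induction_on with
  | empty => simp [binomExp_empty]
  | insert a A ha ih =>
    rw [binomExp_insert ha, ih, Finset.card_insert_of_notMem ha]
    simp [binomExp_const, pow_succ, mul_comm]

theorem binomExp_ne_empty (A : Finset α) :
    binomExp p A (fun S => if S = ∅ then 0 else 1) = 1 - (1 - p) ^ A.card := by
  have h := binomExp_add (p := p) A (fun S => if S = ∅ then 0 else 1)
    (fun S => if S = ∅ then 1 else 0)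
  rw [binomExp_eq_empty] at h
  have h2 : binomExp p A (fun S => (if S = ∅ then (0 : ℝ) else 1) + if S = ∅ then 1 else 0) =
      1 := by
    refine (binomExp_congr fun S _ => ?_).trans (binomExp_const (p := p) A 1)
    split_ifs <;> simp
  linarith

/-- A binomial random set meets each of several disjoint sets independently. -/
theorem binomExp_forall_inter_nonempty {ι : Type*} [DecidableEq ι] (R : Finset ι) (P : ι → Finset α)
    (T : Finset α) (hP : ∀ u ∈ R, P u ⊆ T)
    (hd : ∀ u ∈ R, ∀ w ∈ R, u ≠ w → Disjoint (P u) (P w)) :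
    binomExp p T (fun N => if ∀ u ∈ R, (N ∩ P u).Nonempty then 1 else 0) =
      ∏ u ∈ R, (1 - (1 - p) ^ (P u).card) := by
  induction R using Finset.induction_on generalizing T with
  | empty => simp [binomExp_const]
  | insert a R ha ih =>
    have hT : T = P a ∪ (T \ P a) := (Finset.union_sdiff_of_subset (hP a (by simp))).symm
    have hsub : ∀ u ∈ R, P u ⊆ T \ P a := fun u hu =>
      Finset.subset_sdiff.2 ⟨hP u (by simp [hu]),
        hd u (by simp [hu]) a (by simp) (fun h => ha (h ▸ hu))⟩
    rw [hT, binomExp_union Finset.disjoint_sdiff, Finset.prod_insert ha,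
      ← ih (T \ P a) hsub (fun u hu w hw => hd u (by simp [hu]) w (by simp [hw])),
      ← binomExp_ne_empty, ← binomExp_mul_const]
    refine binomExp_congr fun S hS => ?_
    rw [← binomExp_const_mul]
    refine binomExp_congr fun S' hS' => ?_
    have h1 : (S ∪ S') ∩ P a = S := by
      ext x
      have := @hS x
      have := @hS' x
      simp only [Finset.mem_inter, Finset.mem_union, Finset.mem_sdiff] at *
      tauto
    have h2 : ∀ u ∈ R, (S ∪ S') ∩ P u = S' ∩ P u := by
      intro u hu
      ext x
      have := @hS x
      have := @hS' x
      have h3 := hsub u hu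
      have := @h3 x
      simp only [Finset.mem_inter, Finset.mem_union, Finset.mem_sdiff] at *
      tauto
    have h4 : (∀ u ∈ insert a R, ((S ∪ S') ∩ P u).Nonempty) ↔
        S ≠ ∅ ∧ ∀ u ∈ R, (S' ∩ P u).Nonempty := by
      rw [Finset.forall_mem_insert, h1, Finset.nonempty_iff_ne_empty]
      exact and_congr_right fun _ => forall₂_congr fun u hu => by rw [h2 u hu]
    by_cases hS0 : S = ∅
    · rw [if_neg fun h => (h4.1 h).1 hS0, if_pos hS0, zero_mul]
    · rw [if_neg hS0, one_mul]
      exact if_congr (h4.trans (and_iff_right hS0)) rfl rfl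

/-- Probability that a binomial random set meets one part and misses the complementary part. -/
theorem binomExp_inter_nonempty_and_subset {T P : Finset α} (hP : P ⊆ T) :
    binomExp p T (fun N => if (N ∩ P).Nonempty ∧ N ⊆ P then 1 else 0) =
      (1 - (1 - p) ^ P.card) * (1 - p) ^ (T \ P).card := by
  have hT : T = P ∪ (T \ P) := (Finset.union_sdiff_of_subset hP).symm
  conv_lhs => rw [hT]
  rw [binomExp_union Finset.disjoint_sdiff, ← binomExp_ne_empty, ← binomExp_mul_const]
  refine binomExp_congr fun S hS => ?_
  rw [← binomExp_eq_empty, ← binomExp_const_mul]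
  refine binomExp_congr fun S' hS' => ?_
  have h1 : (S ∪ S') ∩ P = S := by
    ext x
    have := @hS x
    have := @hS' x
    simp only [Finset.mem_inter, Finset.mem_union, Finset.mem_sdiff] at *
    tauto
  have h2 : S ∪ S' ⊆ P ↔ S' = ∅ := by
    constructor
    · intro h
      rw [Finset.eq_empty_iff_forall_notMem]
      intro x hx
      have h3 := h (Finset.mem_union_right _ hx)
      exact (Finset.mem_sdiff.1 (hS' hx)).2 h3
    · rintro rfl
      simpa using hS
  simp only [h1, h2, Finset.nonempty_iff_ne_empty]
  by_cases hS0 : S = ∅ <;> by_cases hS1 : S' = ∅ <;> simp [hS0, hS1]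

end BinomialSubset

section Bipartite

variable {V : Type*} [DecidableEq V] {p : ℝ}

/-- The unordered pairs with one end in `T` and the other end in `W`. -/
def crossPairs (T W : Finset V) : Finset (Sym2 V) :=
  W.biUnion fun x => T.image fun t => s(t, x)

/-- The neighbours in `T` of `x` along the pairs in `S`. -/
def nbrsIn (T : Finset V) (S : Finset (Sym2 V)) (x : V) : Finset V :=
  T.filter fun t => s(t, x) ∈ S

theorem mem_crossPairs {T W : Finset V} {e : Sym2 V} :
    e ∈ crossPairs T W ↔ ∃ x ∈ W, ∃ t ∈ T, s(t, x) = e := by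
  simp [crossPairs]

theorem binomExp_crossPairs {T W : Finset V} (h : Disjoint T W) (g : Finset V → ℝ) :
    binomExp p (crossPairs T W) (fun S => ∏ x ∈ W, g (nbrsIn T S x)) =
      binomExp p T g ^ W.card := by
  induction W using Finset.induction_on with
  | empty => simp [crossPairs, binomExp_empty]
  | insert a W ha ih =>
    rw [Finset.disjoint_insert_right] at h
    have e1 : crossPairs T (insert a W) = (T.image fun t => s(t, a)) ∪ crossPairs T W := by
      simp [crossPairs, Finset.biUnion_insert]
    have hWT : ∀ y ∈ W, y ∉ T := fun y hy hyT => Finset.disjoint_left.1 h.2 hyT hy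
    have e2 : Disjoint (T.image fun t => s(t, a)) (crossPairs T W) := by
      rw [Finset.disjoint_left]
      intro e he he'
      obtain ⟨t, ht, rfl⟩ := Finset.mem_image.1 he
      obtain ⟨x, hx, t', ht', hh⟩ := mem_crossPairs.1 he'
      rw [Sym2.eq_iff] at hh
      rcases hh with ⟨_, rfl⟩ | ⟨rfl, _⟩
      · exact ha hx
      · exact h.1 ht'
    have hinj : Set.InjOn (fun t => s(t, a)) (T : Set V) := by
      intro t _ t' _ hh
      exact Sym2.congr_left.1 hh
    rw [e1, binomExp_union e2, binomExp_image hinj, Finset.card_insert_of_notMem ha, pow_succ',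
      ← binomExp_mul_const]
    refine binomExp_congr fun S hS => ?_
    rw [← ih h.2, ← binomExp_const_mul]
    refine binomExp_congr fun S' hS' => ?_
    rw [Finset.prod_insert ha]
    congr 1
    · congr 1
      ext t
      simp only [nbrsIn, Finset.mem_filter, Finset.mem_union, Finset.mem_image]
      constructor
      · rintro ⟨_, ⟨t', ht', hh⟩ | hh⟩
        · have : t' = t := Sym2.congr_left.1 hh
          exact this ▸ ht'
        · obtain ⟨x, hx, t', ht', hh⟩ := mem_crossPairs.1 (hS' hh)
          rw [Sym2.eq_iff] at hh
          rcases hh with ⟨_, rfl⟩ | ⟨rfl, _⟩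
          · exact absurd hx ha
          · exact absurd ht' h.1
      · intro ht
        exact ⟨hS ht, Or.inl ⟨t, ht, rfl⟩⟩
    · refine Finset.prod_congr rfl fun y hy => ?_
      congr 1
      ext t
      simp only [nbrsIn, Finset.mem_filter, Finset.mem_union, Finset.mem_image]
      refine and_congr_right fun ht => ⟨?_, Or.inr⟩
      rintro (⟨t', ht', hh⟩ | hh)
      · rw [Sym2.eq_iff] at hh
        rcases hh with ⟨_, rfl⟩ | ⟨rfl, _⟩
        · exact absurd hy ha
        · exact absurd (hS ht') (hWT _ hy)
      · exact hh

variable {T W : Finset V} (Q : Finset V → Prop) [DecidablePred Q]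

theorem binomExp_exp_card (h : Disjoint T W) (h0 : 0 ≤ p) (h1 : p ≤ 1) (s : ℝ) :
    binomExp p (crossPairs T W)
        (fun S => Real.exp (s * ((W.filter fun x => Q (nbrsIn T S x)).card : ℝ))) ≤
      Real.exp ((W.card * binomExp p T fun N => if Q N then 1 else 0) * (Real.exp s - 1)) := by
  have e1 : ∀ S, Real.exp (s * ((W.filter fun x => Q (nbrsIn T S x)).card : ℝ)) =
      ∏ x ∈ W, (fun N => if Q N then Real.exp s else 1) (nbrsIn T S x) := by
    intro S
    rw [Finset.prod_ite, Finset.prod_const, Finset.prod_const_one, mul_one, ← Real.exp_nat_mul,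
      mul_comm]
  have e2 : binomExp p T (fun N => if Q N then Real.exp s else 1) =
      1 + (binomExp p T fun N => if Q N then 1 else 0) * (Real.exp s - 1) := by
    have e3 := binomExp_add (p := p) T (fun _ => 1)
      (fun N => (if Q N then 1 else 0) * (Real.exp s - 1))
    rw [binomExp_const, binomExp_mul_const] at e3
    rw [← e3]
    refine binomExp_congr fun N _ => ?_
    split_ifs <;> simp
  rw [binomExp_congr fun S _ => e1 S,
    binomExp_crossPairs h (fun N => if Q N then Real.exp s else 1), mul_assoc, Real.exp_nat_mul]
  refine pow_le_pow_left₀ ?_ ?_ _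
  · refine binomExp_nonneg h0 h1 fun N _ => ?_
    split_ifs
    · positivity
    · simp
  · rw [e2, add_comm]
    exact Real.add_one_le_exp _

theorem binomExp_upper_tail (h : Disjoint T W) (h0 : 0 ≤ p) (h1 : p ≤ 1) {m ε : ℝ}
    (hm : (W.card * binomExp p T fun N => if Q N then 1 else 0) ≤ m) (hε : 0 ≤ ε) (hε1 : ε ≤ 1) :
    binomExp p (crossPairs T W) (fun S =>
        if (1 + ε) * m < ((W.filter fun x => Q (nbrsIn T S x)).card : ℝ) then 1 else 0) ≤
      Real.exp (-(m * ε ^ 2 / 4)) := by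
  have hm0 : 0 ≤ m := le_trans (mul_nonneg (by positivity)
    (binomExp_nonneg h0 h1 fun N _ => by split_ifs <;> simp)) hm
  calc _ ≤ binomExp p (crossPairs T W) (fun S =>
        Real.exp (ε / 2 * ((W.filter fun x => Q (nbrsIn T S x)).card : ℝ)) *
          Real.exp (-(ε / 2 * ((1 + ε) * m)))) := by
        refine binomExp_mono h0 h1 fun S _ => ?_
        split_ifs with hlt
        · rw [← Real.exp_add]
          refine Real.one_le_exp ?_
          nlinarith
        · positivity
    _ ≤ Real.exp (m * (Real.exp (ε / 2) - 1)) * Real.exp (-(ε / 2 * ((1 + ε) * m))) := by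
        rw [binomExp_mul_const]
        refine mul_le_mul_of_nonneg_right ((binomExp_exp_card Q h h0 h1 _).trans ?_) (by positivity)
        refine Real.exp_le_exp.2 (mul_le_mul_of_nonneg_right hm ?_)
        have := Real.add_one_le_exp (ε / 2)
        linarith
    _ ≤ _ := by
        rw [← Real.exp_add]
        refine Real.exp_le_exp.2 ?_
        have h2 : |ε / 2| ≤ 1 := by rw [abs_le]; constructor <;> linarith
        have h3 := (abs_le.1 (Real.abs_exp_sub_one_sub_id_le h2)).2
        nlinarith [mul_le_mul_of_nonneg_left h3 hm0]

theorem binomExp_lower_tail (h : Disjoint T W) (h0 : 0 ≤ p) (h1 : p ≤ 1) {m ε : ℝ} (hm0 : 0 ≤ m)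
    (hm : m ≤ (W.card * binomExp p T fun N => if Q N then 1 else 0)) (hε : 0 ≤ ε) (hε1 : ε ≤ 1) :
    binomExp p (crossPairs T W) (fun S =>
        if ((W.filter fun x => Q (nbrsIn T S x)).card : ℝ) < (1 - ε) * m then 1 else 0) ≤
      Real.exp (-(m * ε ^ 2 / 4)) := by
  calc _ ≤ binomExp p (crossPairs T W) (fun S =>
        Real.exp (-(ε / 2) * ((W.filter fun x => Q (nbrsIn T S x)).card : ℝ)) *
          Real.exp (ε / 2 * ((1 - ε) * m))) := by
        refine binomExp_mono h0 h1 fun S _ => ?_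
        split_ifs with hlt
        · rw [← Real.exp_add]
          refine Real.one_le_exp ?_
          nlinarith
        · positivity
    _ ≤ Real.exp (m * (Real.exp (-(ε / 2)) - 1)) * Real.exp (ε / 2 * ((1 - ε) * m)) := by
        rw [binomExp_mul_const]
        refine mul_le_mul_of_nonneg_right ((binomExp_exp_card Q h h0 h1 _).trans ?_) (by positivity)
        refine Real.exp_le_exp.2 (mul_le_mul_of_nonpos_right hm ?_)
        have : Real.exp (-(ε / 2)) ≤ 1 := Real.exp_le_one_iff.2 (by linarith)
        linarith
    _ ≤ _ := by
        rw [← Real.exp_add]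
        refine Real.exp_le_exp.2 ?_
        have h2 : |-(ε / 2)| ≤ 1 := by rw [abs_le]; constructor <;> linarith
        have h3 := (abs_le.1 (Real.abs_exp_sub_one_sub_id_le h2)).2
        nlinarith [mul_le_mul_of_nonneg_left h3 hm0]

end Bipartite

section OpenBalls

variable {V : Type*} [Fintype V] [DecidableEq V] {G G' : SimpleGraph V}

open Classical in
/-- The vertices at distance less than `k` from the set `R`. -/
noncomputable def openBall (G : SimpleGraph V) : ℕ → Finset V → Finset V
  | 0, _ => ∅
  | k + 1, R => R ∪ Finset.univ.filter fun x => ∃ y ∈ openBall G k R, y = x ∨ G.Adj y x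

/-- The vertices at distance exactly `k` from the set `R`. -/
noncomputable def layer (G : SimpleGraph V) (k : ℕ) (R : Finset V) : Finset V :=
  openBall G (k + 1) R \ openBall G k R

/-- The vertices at distance more than `k` from the set `R`. -/
noncomputable def outside (G : SimpleGraph V) (k : ℕ) (R : Finset V) : Finset V :=
  Finset.univ \ openBall G (k + 1) R

/-- The vertices at distance exactly `k` from `u` and more than `k` from the rest of `R`,
and not closer than `k` to `R`. -/
noncomputable def privateLayer (G : SimpleGraph V) (k : ℕ) (R : Finset V) (u : V) : Finset V :=
  layer G k R \ openBall G (k + 1) (R.erase u)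

theorem mem_openBall_succ {k : ℕ} {R : Finset V} {x : V} :
    x ∈ openBall G (k + 1) R ↔ x ∈ R ∨ ∃ y ∈ openBall G k R, y = x ∨ G.Adj y x := by
  simp [openBall]

theorem openBall_subset_succ (k : ℕ) (R : Finset V) :
    openBall G k R ⊆ openBall G (k + 1) R := fun x hx =>
  mem_openBall_succ.2 (Or.inr ⟨x, hx, Or.inl rfl⟩)

theorem openBall_mono_right {R R' : Finset V} (h : R' ⊆ R) (k : ℕ) :
    openBall G k R' ⊆ openBall G k R := by
  induction k with
  | zero => simp [openBall]
  | succ k ih =>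
    intro x hx
    rw [mem_openBall_succ] at hx ⊢
    rcases hx with hx | ⟨y, hy, hx⟩
    · exact Or.inl (h hx)
    · exact Or.inr ⟨y, ih hy, hx⟩

theorem mem_openBall_iff_exists {k : ℕ} {R : Finset V} {x : V} :
    x ∈ openBall G k R ↔ ∃ u ∈ R, x ∈ openBall G k {u} := by
  refine ⟨fun h => ?_, fun ⟨u, hu, h⟩ => openBall_mono_right (by simpa using hu) k h⟩
  induction k generalizing x with
  | zero => simp [openBall] at h
  | succ k ih =>
    rw [mem_openBall_succ] at h
    rcases h with h | ⟨y, hy, h⟩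
    · exact ⟨x, h, mem_openBall_succ.2 (by simp)⟩
    · obtain ⟨u, hu, h'⟩ := ih hy
      exact ⟨u, hu, mem_openBall_succ.2 (Or.inr ⟨y, h', h⟩)⟩

theorem openBall_congr {k : ℕ} {R : Finset V}
    (h : ∀ a ∈ openBall G k R, ∀ y, G.Adj a y ↔ G'.Adj a y) {m : ℕ} (hm : m ≤ k + 1) :
    openBall G m R = openBall G' m R := by
  induction m with
  | zero => rfl
  | succ m ih =>
    have hsub : ∀ j, openBall G m R ⊆ openBall G (m + j) R := by
      intro j
      induction j with
      | zero => rfl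
      | succ j ihj => exact ihj.trans (openBall_subset_succ _ _)
    have hmk : openBall G m R ⊆ openBall G k R := by
      obtain ⟨j, rfl⟩ := Nat.exists_eq_add_of_le (Nat.le_of_succ_le_succ hm)
      exact hsub j
    ext x
    rw [mem_openBall_succ, mem_openBall_succ, ← ih (by omega)]
    refine or_congr_right (exists_congr fun y => and_congr_right fun hy => ?_)
    rw [h y (hmk hy)]

theorem mem_openBall_of_walk {u x : V} (w : G.Walk u x) : x ∈ openBall G (w.length + 1) {u} := by
  induction w using SimpleGraph.Walk.concatRec with
  | Hnil => simp [mem_openBall_succ]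
  | Hconcat w h ih =>
    rw [SimpleGraph.Walk.length_concat]
    exact mem_openBall_succ.2 (Or.inr ⟨_, ih, Or.inr h⟩)

theorem exists_walk_of_mem_openBall {k : ℕ} {u x : V} (h : x ∈ openBall G k {u}) :
    ∃ w : G.Walk u x, w.length < k := by
  induction k generalizing x with
  | zero => simp [openBall] at h
  | succ k ih =>
    rcases mem_openBall_succ.1 h with h | ⟨y, hy, h⟩
    · rw [Finset.mem_singleton] at h
      subst h
      exact ⟨SimpleGraph.Walk.nil, by simp⟩
    · obtain ⟨w, hw⟩ := ih hy
      rcases h with rfl | h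
      · exact ⟨w, by omega⟩
      · exact ⟨w.concat h, by rw [SimpleGraph.Walk.length_concat]; omega⟩

theorem openBall_mono_left {k m : ℕ} (h : k ≤ m) (R : Finset V) :
    openBall G k R ⊆ openBall G m R := by
  obtain ⟨j, rfl⟩ := Nat.exists_eq_add_of_le h
  induction j with
  | zero => rfl
  | succ j ih => exact (ih (by omega)).trans (openBall_subset_succ _ _)

theorem dist_eq_of_mem_layer {k : ℕ} {u x : V} (h1 : x ∈ openBall G (k + 1) {u})
    (h2 : x ∉ openBall G k {u}) : G.dist u x = k := by
  obtain ⟨w, hw⟩ := exists_walk_of_mem_openBall h1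
  refine le_antisymm ((SimpleGraph.dist_le w).trans (by omega)) ?_
  by_contra! hlt
  obtain ⟨w', hw'⟩ := w.reachable.exists_walk_length_eq_dist
  exact h2 (openBall_mono_left (by omega) _ (mem_openBall_of_walk w'))

theorem mem_openBall_of_dist_eq {k : ℕ} {u x : V} (h : G.dist u x = k + 1) :
    x ∈ openBall G (k + 2) {u} := by
  have hr : G.Reachable u x := by
    by_contra hr
    rw [SimpleGraph.dist_eq_zero_of_not_reachable hr] at h
    omega
  obtain ⟨w, hw⟩ := hr.exists_walk_length_eq_dist
  exact openBall_mono_left (by omega) _ (mem_openBall_of_walk w)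

theorem exists_adj_layer_of_mem_openBall {k : ℕ} {R : Finset V} {x : V} (hx : x ∈ outside G k R)
    {R' : Finset V} (hR' : R' ⊆ R) (h : x ∈ openBall G (k + 2) R') :
    ∃ t ∈ layer G k R, t ∈ openBall G (k + 1) R' ∧ G.Adj t x := by
  have hx' : x ∉ openBall G (k + 1) R := (Finset.mem_sdiff.1 hx).2
  rcases mem_openBall_succ.1 h with h | ⟨y, hy, rfl | h⟩
  · exact absurd (mem_openBall_succ.2 (Or.inl (hR' h))) hx'
  · exact absurd (openBall_mono_right hR' _ hy) hx'
  · refine ⟨y, Finset.mem_sdiff.2 ⟨openBall_mono_right hR' _ hy, fun hy' => hx' ?_⟩, hy, h⟩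
    exact mem_openBall_succ.2 (Or.inr ⟨y, hy', Or.inr h⟩)

theorem mem_layer_succ {k : ℕ} {R : Finset V} {x : V} :
    x ∈ layer G (k + 1) R ↔ x ∈ outside G k R ∧ ∃ t ∈ layer G k R, G.Adj t x := by
  constructor
  · intro h
    have h' := Finset.mem_sdiff.1 h
    have hx : x ∈ outside G k R := Finset.mem_sdiff.2 ⟨Finset.mem_univ _, h'.2⟩
    obtain ⟨t, ht, -, hadj⟩ := exists_adj_layer_of_mem_openBall hx subset_rfl h'.1
    exact ⟨hx, t, ht, hadj⟩
  · rintro ⟨hx, t, ht, hadj⟩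
    exact Finset.mem_sdiff.2 ⟨mem_openBall_succ.2 (Or.inr ⟨t, (Finset.mem_sdiff.1 ht).1,
      Or.inr hadj⟩), (Finset.mem_sdiff.1 hx).2⟩

theorem privateLayer_subset (k : ℕ) (R : Finset V) (u : V) :
    privateLayer G k R u ⊆ layer G k R := Finset.sdiff_subset

theorem mem_openBall_of_mem_privateLayer {k : ℕ} {R : Finset V} {u x : V}
    (h : x ∈ privateLayer G k R u) : x ∈ openBall G (k + 1) {u} := by
  have h' := Finset.mem_sdiff.1 h
  obtain ⟨w, hw, hx⟩ := mem_openBall_iff_exists.1 (Finset.mem_sdiff.1 h'.1).1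
  by_cases hwu : w = u
  · exact hwu ▸ hx
  · exact absurd (mem_openBall_iff_exists.2 ⟨w, Finset.mem_erase.2 ⟨hwu, hw⟩, hx⟩) h'.2

theorem disjoint_privateLayer {k : ℕ} {R : Finset V} {u w : V} (hw : w ∈ R) (h : u ≠ w) :
    Disjoint (privateLayer G k R u) (privateLayer G k R w) := by
  rw [Finset.disjoint_left]
  intro x hx hx'
  have h1 := mem_openBall_of_mem_privateLayer hx'
  exact (Finset.mem_sdiff.1 hx).2
    (mem_openBall_iff_exists.2 ⟨w, Finset.mem_erase.2 ⟨h.symm, hw⟩, h1⟩)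

theorem dist_eq_of_adj_privateLayer {k : ℕ} {R : Finset V} {u t x : V} (hu : u ∈ R)
    (hx : x ∈ outside G k R) (ht : t ∈ privateLayer G k R u) (hadj : G.Adj t x) :
    G.dist u x = k + 1 := by
  refine dist_eq_of_mem_layer (mem_openBall_succ.2 (Or.inr ⟨t,
    mem_openBall_of_mem_privateLayer ht, Or.inr hadj⟩)) fun h => (Finset.mem_sdiff.1 hx).2 ?_
  exact openBall_mono_right (by simpa using hu) _ h

theorem dist_ne_of_forall_adj_privateLayer {k : ℕ} {R : Finset V} {u w x : V} (hw : w ∈ R)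
    (huw : u ≠ w) (hx : x ∈ outside G k R)
    (h : ∀ t ∈ layer G k R, G.Adj t x → t ∈ privateLayer G k R u) : G.dist w x ≠ k + 1 := by
  intro hd
  have hwR : {w} ⊆ R.erase u := by simp [hw, huw.symm]
  obtain ⟨t, ht, ht', hadj⟩ := exists_adj_layer_of_mem_openBall hx (by simpa using hw)
    (mem_openBall_of_dist_eq hd)
  exact (Finset.mem_sdiff.1 (h t ht hadj)).2 (openBall_mono_right hwR _ ht')

/-- The graphs `G` and `G'` have the same open balls of radius at most `k + 1` around all subsets
of `R`. -/
def SameBalls (k : ℕ) (R : Finset V) (G G' : SimpleGraph V) : Prop :=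
  ∀ R' ⊆ R, ∀ m ≤ k + 1, openBall G m R' = openBall G' m R'

theorem sameBalls_of_adj_iff {k : ℕ} {R : Finset V}
    (h : ∀ a ∈ openBall G k R, ∀ y, G.Adj a y ↔ G'.Adj a y) : SameBalls k R G G' :=
  fun _ hR' _ hm => openBall_congr (fun a ha => h a (openBall_mono_right hR' k ha)) hm

theorem SameBalls.symm {k : ℕ} {R : Finset V} (h : SameBalls k R G G') : SameBalls k R G' G :=
  fun R' hR' m hm => (h R' hR' m hm).symm

theorem SameBalls.layer_eq {k : ℕ} {R : Finset V} (h : SameBalls k R G G') :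
    layer G k R = layer G' k R := by
  unfold layer
  rw [h R subset_rfl _ le_rfl, h R subset_rfl k (by omega)]

theorem SameBalls.outside_eq {k : ℕ} {R : Finset V} (h : SameBalls k R G G') :
    outside G k R = outside G' k R := by
  unfold outside
  rw [h R subset_rfl _ le_rfl]

theorem SameBalls.privateLayer_eq {k : ℕ} {R : Finset V} (h : SameBalls k R G G') (u : V) :
    privateLayer G k R u = privateLayer G' k R u := by
  unfold privateLayer
  rw [h.layer_eq, h _ (Finset.erase_subset _ _) _ le_rfl]

theorem disjoint_layer_outside (k : ℕ) (R : Finset V) :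
    Disjoint (layer G k R) (outside G k R) := by
  rw [Finset.disjoint_left]
  intro x hx hx'
  exact (Finset.mem_sdiff.1 hx').2 (Finset.mem_sdiff.1 hx).1

end OpenBalls

section RandomGraph

variable {n : ℕ} {p : ℝ}

open Classical in
/-- The pairs of distinct vertices. -/
noncomputable def properPairs (n : ℕ) : Finset (Sym2 (Fin n)) :=
  Finset.univ.filter fun e => ¬ e.IsDiag

/-- The graph with a given set of edges. -/
def graphOf (S : Finset (Sym2 (Fin n))) : SimpleGraph (Fin n) :=
  SimpleGraph.fromEdgeSet (S : Set (Sym2 (Fin n)))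

theorem card_properPairs : (properPairs n).card = n.choose 2 := by
  classical
  have h := SimpleGraph.card_edgeFinset_top_eq_card_choose_two (V := Fin n)
  rw [Fintype.card_fin] at h
  rw [← h]
  congr 1
  ext e
  simp [properPairs]

theorem gnpProb_eq_binomExp (A : Set (SimpleGraph (Fin n))) :
    gnpProb n p A = binomExp p (properPairs n) fun S => A.indicator (fun _ => 1) (graphOf S) := by
  classical
  unfold gnpProb binomExp
  rw [tsum_fintype]
  refine Finset.sum_bij' (fun G _ => G.edgeFinset) (fun S _ => graphOf S) ?_ ?_ ?_ ?_ ?_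
  · intro G _
    rw [Finset.mem_powerset]
    intro e he
    rw [SimpleGraph.mem_edgeFinset] at he
    simp [properPairs, G.not_isDiag_of_mem_edgeSet he]
  · simp
  · intro G _
    simp [graphOf]
  · intro S hS
    rw [Finset.mem_powerset] at hS
    ext e
    rw [SimpleGraph.mem_edgeFinset, graphOf, SimpleGraph.edgeSet_fromEdgeSet]
    refine ⟨fun h => h.1, fun h => ⟨h, ?_⟩⟩
    have := hS h
    simp only [properPairs, Finset.mem_filter] at this
    exact this.2
  · intro G _
    have h1 : graphOf G.edgeFinset = G := by simp [graphOf]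
    simp only [h1, card_properPairs]
    by_cases hG : G ∈ A
    · simp [hG, gnpWeight, SimpleGraph.edgeFinset_card, Nat.card_eq_fintype_card]
    · simp [hG]

theorem gnpProb_mono (h0 : 0 ≤ p) (h1 : p ≤ 1) {A B : Set (SimpleGraph (Fin n))} (h : A ⊆ B) :
    gnpProb n p A ≤ gnpProb n p B := by
  rw [gnpProb_eq_binomExp, gnpProb_eq_binomExp]
  exact binomExp_mono h0 h1 fun S _ =>
    Set.indicator_le_indicator_of_subset h (fun _ => zero_le_one) _

theorem gnpProb_compl (A : Set (SimpleGraph (Fin n))) :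
    gnpProb n p Aᶜ = 1 - gnpProb n p A := by
  rw [gnpProb_eq_binomExp, gnpProb_eq_binomExp, eq_sub_iff_add_eq, ← binomExp_add]
  refine (binomExp_congr fun S _ => ?_).trans (binomExp_const (p := p) (properPairs n) 1)
  by_cases h : graphOf S ∈ A <;> simp [h]

theorem gnpProb_nonneg (h0 : 0 ≤ p) (h1 : p ≤ 1) (A : Set (SimpleGraph (Fin n))) :
    0 ≤ gnpProb n p A := by
  rw [gnpProb_eq_binomExp]
  exact binomExp_nonneg h0 h1 fun S _ => Set.indicator_nonneg (by simp) _

theorem gnpProb_union_le (h0 : 0 ≤ p) (h1 : p ≤ 1) (A B : Set (SimpleGraph (Fin n))) :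
    gnpProb n p (A ∪ B) ≤ gnpProb n p A + gnpProb n p B := by
  simp_rw [gnpProb_eq_binomExp]
  rw [← binomExp_add]
  refine binomExp_mono h0 h1 fun S _ => ?_
  by_cases hA : graphOf S ∈ A <;> by_cases hB : graphOf S ∈ B <;> simp [hA, hB]

theorem gnpProb_exists_le {ι : Type*} (h0 : 0 ≤ p) (h1 : p ≤ 1) (I : Finset ι)
    (A : ι → Set (SimpleGraph (Fin n))) {η : ℝ} (h : ∀ j ∈ I, gnpProb n p (A j) ≤ η) :
    gnpProb n p {G | ∃ j ∈ I, G ∈ A j} ≤ I.card * η := by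
  classical
  induction I using Finset.induction_on with
  | empty => simp [gnpProb]
  | insert a I ha ih =>
    have e : {G | ∃ j ∈ insert a I, G ∈ A j} = A a ∪ {G | ∃ j ∈ I, G ∈ A j} := by
      ext G
      simp
    rw [e, Finset.card_insert_of_notMem ha]
    have h2 := gnpProb_union_le h0 h1 (A a) {G | ∃ j ∈ I, G ∈ A j}
    have h3 := h a (by simp)
    have h4 := ih fun j hj => h j (by simp [hj])
    push_cast
    linarith

theorem graphOf_adj {S : Finset (Sym2 (Fin n))} {a b : Fin n} :
    (graphOf S).Adj a b ↔ s(a, b) ∈ S ∧ a ≠ b := by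
  simp [graphOf]

/-- Exposing a random graph outside the pairs between a layer and the vertices beyond it leaves
these pairs independent. -/
theorem gnpProb_le_of_layer (h0 : 0 ≤ p) (h1 : p ≤ 1) (R : Finset (Fin n)) (k : ℕ)
    (A : Set (SimpleGraph (Fin n))) {η : ℝ}
    (D : SimpleGraph (Fin n) → Finset (Sym2 (Fin n)) → Prop) [∀ G S, Decidable (D G S)]
    (hA : ∀ G₀ G, SameBalls k R G₀ G → ∀ S',
      (∀ x ∈ outside G₀ k R, ∀ t ∈ layer G₀ k R, s(t, x) ∈ S' ↔ G.Adj t x) → G ∈ A → D G₀ S')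
    (hD : ∀ G₀, binomExp p (crossPairs (layer G₀ k R) (outside G₀ k R))
      (fun S => if D G₀ S then 1 else 0) ≤ η) :
    gnpProb n p A ≤ η := by
  classical
  let code : SimpleGraph (Fin n) → Finset (Fin n) × Finset (Fin n) :=
    fun G => (openBall G k R, openBall G (k + 1) R)
  have hsplit : ∀ S, A.indicator (fun _ => (1 : ℝ)) (graphOf S) =
      ∑ q : Finset (Fin n) × Finset (Fin n),
        if code (graphOf S) = q then A.indicator (fun _ => (1 : ℝ)) (graphOf S) else 0 := by
    intro S
    simp
  have hone : ∀ S : Finset (Sym2 (Fin n)), η =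
      ∑ q : Finset (Fin n) × Finset (Fin n), if code (graphOf S) = q then η else 0 := by
    intro S
    simp
  rw [gnpProb_eq_binomExp, ← binomExp_const (p := p) (properPairs n) η,
    binomExp_congr fun S _ => hsplit S, binomExp_congr fun S _ => hone S, binomExp_sum,
    binomExp_sum]
  refine Finset.sum_le_sum fun q _ => ?_
  by_cases hsub : q.1 ⊆ q.2
  swap
  · refine binomExp_mono h0 h1 fun S _ => ?_
    have : code (graphOf S) ≠ q := by
      rintro rfl
      exact hsub (openBall_subset_succ _ _)
    simp [this]
  set T := q.2 \ q.1 with hT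
  set W := Finset.univ \ q.2 with hW
  set F := crossPairs T W with hF
  have hFsub : F ⊆ properPairs n := by
    intro e he
    obtain ⟨x, hx, t, ht, rfl⟩ := mem_crossPairs.1 he
    have : t ≠ x := by
      rintro rfl
      exact (Finset.mem_sdiff.1 hx).2 (Finset.mem_sdiff.1 ht).1
    simp [properPairs, this]
  have hFU : ∀ a ∈ q.1, ∀ y, s(a, y) ∉ F := by
    intro a ha y hay
    obtain ⟨x, hx, t, ht, hh⟩ := mem_crossPairs.1 hay
    rw [Sym2.eq_iff] at hh
    rcases hh with ⟨rfl, rfl⟩ | ⟨rfl, rfl⟩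
    · exact (Finset.mem_sdiff.1 ht).2 ha
    · exact (Finset.mem_sdiff.1 hx).2 (hsub ha)
  have hadj : ∀ S₁, ∀ S₂ ⊆ F, ∀ a ∈ q.1, ∀ y,
      (graphOf S₁).Adj a y ↔ (graphOf (S₁ ∪ S₂)).Adj a y := by
    intro S₁ S₂ hS₂ a ha y
    rw [graphOf_adj, graphOf_adj, Finset.mem_union]
    have := fun h => hFU a ha y (hS₂ h)
    tauto
  have hsame : ∀ S₁, ∀ S₂ ⊆ F, code (graphOf S₁) = q →
      SameBalls k R (graphOf S₁) (graphOf (S₁ ∪ S₂)) := by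
    rintro S₁ S₂ hS₂ hq
    refine sameBalls_of_adj_iff fun a ha => hadj S₁ S₂ hS₂ a ?_
    rw [← hq]
    exact ha
  have hsame' : ∀ S₁, ∀ S₂ ⊆ F, code (graphOf (S₁ ∪ S₂)) = q →
      SameBalls k R (graphOf S₁) (graphOf (S₁ ∪ S₂)) := by
    rintro S₁ S₂ hS₂ hq
    refine (sameBalls_of_adj_iff fun a ha y => (hadj S₁ S₂ hS₂ a ?_ y).symm).symm
    rw [← hq]
    exact ha
  have hcode : ∀ S₁ S₂, SameBalls k R (graphOf S₁) (graphOf (S₁ ∪ S₂)) →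
      code (graphOf S₁) = code (graphOf (S₁ ∪ S₂)) := by
    intro S₁ S₂ h
    simp only [code]
    rw [h R subset_rfl k (by omega), h R subset_rfl (k + 1) le_rfl]
  have hE : properPairs n = (properPairs n \ F) ∪ F := (Finset.sdiff_union_of_subset hFsub).symm
  rw [hE, binomExp_union Finset.sdiff_disjoint, binomExp_union Finset.sdiff_disjoint]
  refine binomExp_mono h0 h1 fun S₁ hS₁ => ?_
  by_cases hq : code (graphOf S₁) = q
  · have e1 : binomExp p F (fun S₂ => if code (graphOf (S₁ ∪ S₂)) = q then η else 0) = η := by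
      rw [← binomExp_const (p := p) F η]
      refine binomExp_congr fun S₂ hS₂ => ?_
      rw [← hcode S₁ S₂ (hsame S₁ S₂ hS₂ hq), if_pos hq, binomExp_const]
    rw [e1]
    have hTe : layer (graphOf S₁) k R = T := by rw [hT, ← hq]; rfl
    have hWe : outside (graphOf S₁) k R = W := by rw [hW, ← hq]; rfl
    refine le_trans (binomExp_mono h0 h1 fun S₂ hS₂ => ?_) (hF ▸ hTe ▸ hWe ▸ hD (graphOf S₁))
    have hs := hsame S₁ S₂ hS₂ hq
    rw [← hcode S₁ S₂ hs, if_pos hq]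
    by_cases hmem : graphOf (S₁ ∪ S₂) ∈ A
    · have : D (graphOf S₁) S₂ := by
        refine hA _ _ hs S₂ (fun x hx t ht => ?_) hmem
        rw [hTe] at ht
        rw [hWe] at hx
        have htx : s(t, x) ∈ F := mem_crossPairs.2 ⟨x, hx, t, ht, rfl⟩
        have hne : t ≠ x := by
          rintro rfl
          exact (Finset.mem_sdiff.1 hx).2 (Finset.mem_sdiff.1 ht).1
        have : s(t, x) ∉ S₁ := fun h => (Finset.mem_sdiff.1 (hS₁ h)).2 htx
        rw [graphOf_adj, Finset.mem_union]
        tauto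
      simp [hmem, this]
    · rw [Set.indicator_of_notMem hmem]
      split_ifs <;> simp
  · have hne : ∀ S₂ ⊆ F, code (graphOf (S₁ ∪ S₂)) ≠ q := by
      intro S₂ hS₂ h
      exact hq ((hcode S₁ S₂ (hsame' S₁ S₂ hS₂ h)).trans h)
    refine binomExp_mono h0 h1 fun S₂ hS₂ => ?_
    simp [hne S₂ hS₂]

open Classical in
/-- The vertices beyond the `k`-th layer of `R` whose neighbourhood in this layer satisfies `Q`. -/
noncomputable def hits (G : SimpleGraph (Fin n)) (k : ℕ) (R : Finset (Fin n))
    (Q : Finset (Fin n) → Prop) : Finset (Fin n) :=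
  (outside G k R).filter fun x => Q ((layer G k R).filter fun t => G.Adj t x)

open Classical in
theorem hits_eq_of_sameBalls {G₀ G : SimpleGraph (Fin n)} {k : ℕ} {R : Finset (Fin n)}
    (hs : SameBalls k R G₀ G) {S' : Finset (Sym2 (Fin n))}
    (h : ∀ x ∈ outside G₀ k R, ∀ t ∈ layer G₀ k R, s(t, x) ∈ S' ↔ G.Adj t x)
    (Q : Finset (Fin n) → Prop) :
    hits G k R Q = (outside G₀ k R).filter fun x => Q (nbrsIn (layer G₀ k R) S' x) := by
  unfold hits
  rw [← hs.layer_eq, ← hs.outside_eq]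
  refine Finset.filter_congr fun x hx => ?_
  have : (layer G₀ k R).filter (fun t => G.Adj t x) = nbrsIn (layer G₀ k R) S' x := by
    unfold nbrsIn
    exact Finset.filter_congr fun t ht => (h x hx t ht).symm
  rw [this]

variable {R : Finset (Fin n)} {k : ℕ} {Good : SimpleGraph (Fin n) → Prop}
  {Q : SimpleGraph (Fin n) → Finset (Fin n) → Prop} {m : SimpleGraph (Fin n) → ℝ} {m₀ ε : ℝ}

open Classical in
theorem gnpProb_lower_tail (h0 : 0 ≤ p) (h1 : p ≤ 1) (hε : 0 ≤ ε) (hε1 : ε ≤ 1) (hm₀ : 0 ≤ m₀)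
    (hinv : ∀ G G', SameBalls k R G G' → (Good G' → Good G) ∧ Q G = Q G' ∧ m G = m G')
    (hm : ∀ G, Good G → m₀ ≤ m G ∧ m G ≤ (outside G k R).card *
      binomExp p (layer G k R) fun N => if Q G N then 1 else 0) :
    gnpProb n p {G | Good G ∧ ((hits G k R (Q G)).card : ℝ) < (1 - ε) * m G} ≤
      Real.exp (-(m₀ * ε ^ 2 / 4)) := by
  refine gnpProb_le_of_layer h0 h1 R k _ (fun G₀ S => Good G₀ ∧
    (((outside G₀ k R).filter fun x => Q G₀ (nbrsIn (layer G₀ k R) S x)).card : ℝ) <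
      (1 - ε) * m G₀) ?_ ?_
  · rintro G₀ G hs S' h ⟨hG, hlt⟩
    obtain ⟨i1, i2, i3⟩ := hinv _ _ hs
    rw [hits_eq_of_sameBalls hs h, ← i2, ← i3] at hlt
    exact ⟨i1 hG, hlt⟩
  · intro G₀
    by_cases hG : Good G₀
    · obtain ⟨h2, h3⟩ := hm G₀ hG
      simp only [hG, true_and]
      refine (binomExp_lower_tail (Q G₀) (disjoint_layer_outside k R) h0 h1 (hm₀.trans h2) h3
        hε hε1).trans (Real.exp_le_exp.2 ?_)
      nlinarith [mul_le_mul_of_nonneg_right h2 (sq_nonneg ε)]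
    · simp only [hG, false_and, if_false, binomExp_const]
      positivity

open Classical in
theorem gnpProb_upper_tail (h0 : 0 ≤ p) (h1 : p ≤ 1) (hε : 0 ≤ ε) (hε1 : ε ≤ 1)
    (hinv : ∀ G G', SameBalls k R G G' → (Good G' → Good G) ∧ Q G = Q G' ∧ m G = m G')
    (hm : ∀ G, Good G → m₀ ≤ m G ∧ (outside G k R).card *
      (binomExp p (layer G k R) fun N => if Q G N then 1 else 0) ≤ m G) :
    gnpProb n p {G | Good G ∧ (1 + ε) * m G < ((hits G k R (Q G)).card : ℝ)} ≤
      Real.exp (-(m₀ * ε ^ 2 / 4)) := by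
  refine gnpProb_le_of_layer h0 h1 R k _ (fun G₀ S => Good G₀ ∧
    (1 + ε) * m G₀ <
      (((outside G₀ k R).filter fun x => Q G₀ (nbrsIn (layer G₀ k R) S x)).card : ℝ)) ?_ ?_
  · rintro G₀ G hs S' h ⟨hG, hlt⟩
    obtain ⟨i1, i2, i3⟩ := hinv _ _ hs
    rw [hits_eq_of_sameBalls hs h, ← i2, ← i3] at hlt
    exact ⟨i1 hG, hlt⟩
  · intro G₀
    by_cases hG : Good G₀
    · obtain ⟨h2, h3⟩ := hm G₀ hG
      simp only [hG, true_and]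
      refine (binomExp_upper_tail (Q G₀) (disjoint_layer_outside k R) h0 h1 h3
        hε hε1).trans (Real.exp_le_exp.2 ?_)
      nlinarith [mul_le_mul_of_nonneg_right h2 (sq_nonneg ε)]
    · simp only [hG, false_and, if_false, binomExp_const]
      positivity

end RandomGraph

section LayerEvents

variable {n : ℕ} {p ε : ℝ} {R : Finset (Fin n)} {k : ℕ}

theorem one_sub_one_sub_pow_le (h1 : p ≤ 1) (t : ℕ) : 1 - (1 - p) ^ t ≤ p * t := by
  have := one_add_mul_le_pow (a := -p) (by linarith) t
  have e : 1 + -p = 1 - p := by ring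
  rw [e] at this
  linarith

theorem one_sub_pow_le_exp (h1 : p ≤ 1) (t : ℕ) : (1 - p) ^ t ≤ Real.exp (-(p * t)) := by
  have h := Real.add_one_le_exp (-p)
  have e : -(p * t) = t * (-p) := by ring
  rw [e, Real.exp_nat_mul]
  exact pow_le_pow_left₀ (by linarith) (by linarith) t

theorem le_one_sub_one_sub_pow (h0 : 0 ≤ p) (h1 : p ≤ 1) {t : ℕ} (ht : p * t ≤ ε) (hε : ε ≤ 1) :
    (1 - ε) * (p * t) ≤ 1 - (1 - p) ^ t := by
  have h2 := one_sub_pow_le_exp h1 t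
  have h3 : 0 ≤ p * t := by positivity
  have h4 : |-(p * t)| ≤ 1 := by rw [abs_le]; constructor <;> linarith
  have h5 := (abs_le.1 (Real.abs_exp_sub_one_sub_id_le h4)).2
  nlinarith

theorem hits_nonempty_eq (G : SimpleGraph (Fin n)) (k : ℕ) (R : Finset (Fin n)) :
    hits G k R (fun N => N.Nonempty) = layer G (k + 1) R := by
  ext x
  simp [hits, mem_layer_succ, Finset.filter_nonempty_iff]

theorem binomExp_nonempty (T : Finset (Fin n)) :
    binomExp p T (fun N => @ite _ N.Nonempty (Classical.propDecidable _) 1 0) =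
      1 - (1 - p) ^ T.card := by
  rw [← binomExp_ne_empty]
  refine binomExp_congr fun S _ => ?_
  by_cases hS : S = ∅
  · simp [hS]
  · simp [hS, Finset.nonempty_iff_ne_empty]

theorem card_outside (G : SimpleGraph (Fin n)) (k : ℕ) (R : Finset (Fin n)) :
    ((outside G k R).card : ℝ) = n - (openBall G (k + 1) R).card := by
  unfold outside
  rw [Finset.cast_card_sdiff (Finset.subset_univ _)]
  simp

theorem gnpProb_layer_succ_gt_le (h0 : 0 ≤ p) (h1 : p ≤ 1) (hR : R.Nonempty) (hε : 0 ≤ ε)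
    (hε1 : ε ≤ 1) :
    gnpProb n p {G | (1 + ε) * (p * (n - 1) * (layer G k R).card) < (layer G (k + 1) R).card} ≤
      Real.exp (-(p * (n - 1) * ε ^ 2 / 4)) := by
  have hn : (1 : ℝ) ≤ n := by
    obtain ⟨x, _⟩ := hR
    exact_mod_cast x.pos
  refine le_trans (gnpProb_mono h0 h1 ?_) (gnpProb_upper_tail (R := R) (k := k)
    (Good := fun G => (layer G k R).Nonempty) (Q := fun _ N => N.Nonempty)
    (m := fun G => p * (n - 1) * (layer G k R).card) h0 h1 hε hε1 ?_ ?_)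
  · intro G hG
    rw [Set.mem_ofPred_eq] at hG ⊢
    rw [hits_nonempty_eq]
    refine ⟨?_, hG⟩
    by_contra hne
    rw [Finset.not_nonempty_iff_eq_empty] at hne
    have : layer G (k + 1) R = ∅ := by
      rw [Finset.eq_empty_iff_forall_notMem]
      intro x hx
      obtain ⟨-, t, ht, -⟩ := mem_layer_succ.1 hx
      simp [hne] at ht
    simp [hne, this] at hG
  · intro G G' hs
    simp [hs.layer_eq]
  · intro G hG
    have hc : (1 : ℝ) ≤ (layer G k R).card := by exact_mod_cast hG.card_pos
    have hpn : 0 ≤ p * (n - 1) := mul_nonneg h0 (by linarith)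
    refine ⟨by nlinarith, ?_⟩
    have e := binomExp_nonempty (p := p) (layer G k R)
    rw [card_outside]
    simp only [e]
    have h2 := one_sub_one_sub_pow_le h1 (layer G k R).card
    have h3 : (1 : ℝ) ≤ (openBall G (k + 1) R).card := by
      obtain ⟨x, hx⟩ := hR
      exact_mod_cast Finset.card_pos.2 ⟨x, mem_openBall_succ.2 (Or.inl hx)⟩
    have h4 : ((openBall G (k + 1) R).card : ℝ) ≤ n := by
      have := Finset.card_le_univ (openBall G (k + 1) R)
      rw [Fintype.card_fin] at this
      exact_mod_cast this
    have h5 : 0 ≤ p * (layer G k R).card := by positivity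
    calc ((n : ℝ) - (openBall G (k + 1) R).card) * (1 - (1 - p) ^ (layer G k R).card)
        ≤ (n - (openBall G (k + 1) R).card) * (p * (layer G k R).card) :=
          mul_le_mul_of_nonneg_left h2 (by linarith)
      _ ≤ (n - 1) * (p * (layer G k R).card) := mul_le_mul_of_nonneg_right (by linarith) h5
      _ = _ := by ring

theorem gnpProb_layer_succ_lt_le (h0 : 0 ≤ p) (h1 : p ≤ 1) (hn : 1 ≤ n) (hε : 0 ≤ ε)
    (hε1 : ε ≤ 1) :
    gnpProb n p {G | ((layer G k R).Nonempty ∧ p * (layer G k R).card ≤ ε ∧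
        ((openBall G (k + 1) R).card : ℝ) ≤ ε * n) ∧
        ((layer G (k + 1) R).card : ℝ) <
          (1 - ε) * ((1 - ε) ^ 2 * (p * (n - 1) * (layer G k R).card))} ≤
      Real.exp (-((1 - ε) ^ 2 * (p * (n - 1)) * ε ^ 2 / 4)) := by
  have hn : (1 : ℝ) ≤ n := by exact_mod_cast hn
  have hpn : 0 ≤ p * (n - 1) := mul_nonneg h0 (by linarith)
  refine le_trans (gnpProb_mono h0 h1 ?_) (gnpProb_lower_tail (R := R) (k := k)
    (Good := fun G => (layer G k R).Nonempty ∧ p * (layer G k R).card ≤ ε ∧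
        ((openBall G (k + 1) R).card : ℝ) ≤ ε * n) (Q := fun _ N => N.Nonempty)
    (m := fun G => (1 - ε) ^ 2 * (p * (n - 1) * (layer G k R).card)) h0 h1 hε hε1
    (by positivity) ?_ ?_)
  · intro G hG
    rw [Set.mem_ofPred_eq] at hG ⊢
    rw [hits_nonempty_eq]
    exact hG
  · intro G G' hs
    simp [hs.layer_eq, hs R subset_rfl (k + 1) le_rfl]
  · rintro G ⟨hG, hG1, hG2⟩
    have hc : (1 : ℝ) ≤ (layer G k R).card := by exact_mod_cast hG.card_pos
    refine ⟨mul_le_mul_of_nonneg_left (by nlinarith) (by positivity), ?_⟩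
    have e := binomExp_nonempty (p := p) (layer G k R)
    rw [card_outside]
    simp only [e]
    have h2 := le_one_sub_one_sub_pow h0 h1 hG1 hε1
    have h5 : 0 ≤ p * (layer G k R).card := by positivity
    calc (1 - ε) ^ 2 * (p * (n - 1) * (layer G k R).card)
        = ((1 - ε) * (n - 1)) * ((1 - ε) * (p * (layer G k R).card)) := by ring
      _ ≤ (n - (openBall G (k + 1) R).card) * ((1 - ε) * (p * (layer G k R).card)) :=
          mul_le_mul_of_nonneg_right (by linarith) (mul_nonneg (by linarith) h5)
      _ ≤ _ := mul_le_mul_of_nonneg_left h2 (by nlinarith)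

theorem gnpProb_private_hits_lt_le (h0 : 0 ≤ p) (h1 : p ≤ 1) (hε : 0 ≤ ε) (hε1 : ε ≤ 1) (u : Fin n)
    {t₁ t₂ y : ℝ} (hy0 : 0 ≤ y)
    (hy : ∀ a b : ℕ, t₁ ≤ a → b ≤ t₂ → y ≤ (1 - (1 - p) ^ a) * (1 - p) ^ b) :
    gnpProb n p {G | (t₁ ≤ (privateLayer G k R u).card ∧
        ((layer G k R \ privateLayer G k R u).card : ℝ) ≤ t₂ ∧
        ((openBall G (k + 1) R).card : ℝ) ≤ ε * n) ∧
        ((hits G k R fun N => (N ∩ privateLayer G k R u).Nonempty ∧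
          N ⊆ privateLayer G k R u).card : ℝ) < (1 - ε) * ((1 - ε) * n * y)} ≤
      Real.exp (-((1 - ε) * n * y * ε ^ 2 / 4)) := by
  have h1ε : 0 ≤ 1 - ε := by linarith
  refine gnpProb_lower_tail (R := R) (k := k)
    (Good := fun G => t₁ ≤ (privateLayer G k R u).card ∧
        ((layer G k R \ privateLayer G k R u).card : ℝ) ≤ t₂ ∧
        ((openBall G (k + 1) R).card : ℝ) ≤ ε * n)
    (Q := fun G N => (N ∩ privateLayer G k R u).Nonempty ∧ N ⊆ privateLayer G k R u)
    (m := fun G => (1 - ε) * n * y) h0 h1 hε hε1 (by positivity) ?_ ?_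
  · intro G G' hs
    simp [hs.layer_eq, hs.privateLayer_eq, hs R subset_rfl (k + 1) le_rfl]
  · rintro G ⟨hG, hG1, hG2⟩
    refine ⟨le_rfl, ?_⟩
    have := binomExp_inter_nonempty_and_subset (p := p) (privateLayer_subset (G := G) k R u)
    have e : (binomExp p (layer G k R) fun N => if (N ∩ privateLayer G k R u).Nonempty ∧
        N ⊆ privateLayer G k R u then 1 else 0) = (1 - (1 - p) ^ (privateLayer G k R u).card) *
          (1 - p) ^ (layer G k R \ privateLayer G k R u).card := by
      rw [← this]
    have h3 := hy _ _ hG hG1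
    rw [card_outside]
    have h4 : (1 - ε) * n ≤ n - (openBall G (k + 1) R).card := by linarith
    refine le_trans (mul_le_mul h4 h3 hy0 (le_trans (by positivity) h4)) (le_of_eq ?_)
    rw [← e]
    congr!

theorem gnpProb_common_hits_lt_le (h0 : 0 ≤ p) (h1 : p ≤ 1)
    {t₁ y : ℝ} (hy0 : 0 ≤ y) (hy : ∀ a : ℕ, t₁ ≤ a → y ≤ 1 - (1 - p) ^ a) :
    gnpProb n p {G | ((∀ u ∈ R, t₁ ≤ (privateLayer G k R u).card) ∧
        ((openBall G (k + 1) R).card : ℝ) ≤ n / 2) ∧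
        ((hits G k R fun N => ∀ u ∈ R, (N ∩ privateLayer G k R u).Nonempty).card : ℝ) <
          (1 - 1 / 2) * (n / 2 * y ^ R.card)} ≤
      Real.exp (-(n / 2 * y ^ R.card * (1 / 2) ^ 2 / 4)) := by
  refine gnpProb_lower_tail (R := R) (k := k)
    (Good := fun G => (∀ u ∈ R, t₁ ≤ (privateLayer G k R u).card) ∧
        ((openBall G (k + 1) R).card : ℝ) ≤ n / 2)
    (Q := fun G N => ∀ u ∈ R, (N ∩ privateLayer G k R u).Nonempty)
    (m := fun G => n / 2 * y ^ R.card) h0 h1 (by norm_num) (by norm_num) (by positivity) ?_ ?_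
  · intro G G' hs
    simp [hs.privateLayer_eq, hs R subset_rfl (k + 1) le_rfl]
  · rintro G ⟨hG, hG1⟩
    refine ⟨le_rfl, ?_⟩
    have e := binomExp_forall_inter_nonempty (p := p) R (privateLayer G k R) (layer G k R)
      (fun u _ => privateLayer_subset k R u) (fun u _ w hw h => disjoint_privateLayer hw h)
    rw [card_outside]
    have h3 : y ^ R.card ≤ ∏ u ∈ R, (1 - (1 - p) ^ (privateLayer G k R u).card) := by
      rw [← Finset.prod_const]
      exact Finset.prod_le_prod (fun _ _ => hy0) fun u hu => hy _ (hG u hu)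
    have h4 : (n : ℝ) / 2 ≤ n - (openBall G (k + 1) R).card := by linarith
    refine le_trans (mul_le_mul h4 h3 (by positivity) (le_trans (by positivity) h4)) (le_of_eq ?_)
    rw [← e]
    congr!

theorem dist_of_mem_private_hits {G : SimpleGraph (Fin n)} {u w x : Fin n} (hu : u ∈ R)
    (hw : w ∈ R) (huw : u ≠ w)
    (hx : x ∈ hits G k R fun N => (N ∩ privateLayer G k R u).Nonempty ∧
      N ⊆ privateLayer G k R u) : G.dist u x = k + 1 ∧ G.dist w x ≠ k + 1 := by
  classical
  simp only [hits, Finset.mem_filter] at hx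
  obtain ⟨hx, ⟨t, ht⟩, hsub⟩ := hx
  rw [Finset.mem_inter, Finset.mem_filter] at ht
  refine ⟨dist_eq_of_adj_privateLayer hu hx ht.2 ht.1.2,
    dist_ne_of_forall_adj_privateLayer hw huw hx fun t ht hadj => ?_⟩
  exact hsub (Finset.mem_filter.2 ⟨ht, hadj⟩)

theorem dist_of_mem_common_hits {G : SimpleGraph (Fin n)} {x : Fin n}
    (hx : x ∈ hits G k R fun N => ∀ u ∈ R, (N ∩ privateLayer G k R u).Nonempty) :
    ∀ u ∈ R, G.dist u x = k + 1 := by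
  classical
  simp only [hits, Finset.mem_filter] at hx
  intro u hu
  obtain ⟨t, ht⟩ := hx.2 u hu
  rw [Finset.mem_inter, Finset.mem_filter] at ht
  exact dist_eq_of_adj_privateLayer hu hx.1 ht.2 ht.1.2

end LayerEvents

section Growth

variable {n : ℕ} {p d ε θ m : ℝ} {i r : ℕ} {G : SimpleGraph (Fin n)}

/-- The layers of `R` grow by a factor of about `p * (n - 1)` at step `k`. -/
def Grows (G : SimpleGraph (Fin n)) (p ε : ℝ) (k : ℕ) (R : Finset (Fin n)) : Prop :=
  ((layer G (k + 1) R).card : ℝ) ≤ (1 + ε) * (p * (n - 1) * (layer G k R).card) ∧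
    ((layer G k R).Nonempty → p * (layer G k R).card ≤ ε →
      ((openBall G (k + 1) R).card : ℝ) ≤ ε * n →
      (1 - ε) * ((1 - ε) ^ 2 * (p * (n - 1) * (layer G k R).card)) ≤ (layer G (k + 1) R).card)

theorem gnpProb_not_grows_le (h0 : 0 ≤ p) (h1 : p ≤ 1) (hε : 0 ≤ ε) (hε1 : ε ≤ 1 / 2) (k : ℕ)
    {R : Finset (Fin n)} (hR : R.Nonempty) :
    gnpProb n p {G | ¬ Grows G p ε k R} ≤ 2 * Real.exp (-(p * (n - 1) * ε ^ 2 / 16)) := by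
  have hn : 1 ≤ n := by
    obtain ⟨x, _⟩ := hR
    exact x.pos
  have hn' : (1 : ℝ) ≤ n := by exact_mod_cast hn
  have hpn : 0 ≤ p * (n - 1) * ε ^ 2 := mul_nonneg (mul_nonneg h0 (by linarith)) (sq_nonneg _)
  have hu := gnpProb_layer_succ_gt_le (k := k) h0 h1 hR hε (by linarith)
  have hl := gnpProb_layer_succ_lt_le (R := R) (k := k) h0 h1 hn hε (by linarith)
  refine (gnpProb_mono h0 h1 ?_).trans ((gnpProb_union_le h0 h1 _ _).trans
    ((add_le_add hu hl).trans ?_))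
  · intro G hG
    by_contra h
    rw [Set.mem_union, not_or, Set.mem_ofPred_eq, Set.mem_ofPred_eq] at h
    refine hG ⟨not_lt.1 h.1, fun a b c => ?_⟩
    by_contra hlt
    exact h.2 ⟨⟨a, b, c⟩, not_le.1 hlt⟩
  · have e1 : Real.exp (-(p * (n - 1) * ε ^ 2 / 4)) ≤
        Real.exp (-(p * (n - 1) * ε ^ 2 / 16)) := Real.exp_le_exp.2 (by linarith)
    have e2 : Real.exp (-((1 - ε) ^ 2 * (p * (n - 1)) * ε ^ 2 / 4)) ≤
        Real.exp (-(p * (n - 1) * ε ^ 2 / 16)) := by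
      refine Real.exp_le_exp.2 ?_
      have : (1 / 4 : ℝ) ≤ (1 - ε) ^ 2 := by nlinarith
      have := mul_le_mul_of_nonneg_right this hpn
      nlinarith
    linarith

theorem layer_zero (G : SimpleGraph (Fin n)) (R : Finset (Fin n)) : layer G 0 R = R := by
  ext x
  simp [layer, openBall]

theorem card_openBall_succ (G : SimpleGraph (Fin n)) (k : ℕ) (R : Finset (Fin n)) :
    (openBall G (k + 1) R).card = (openBall G k R).card + (layer G k R).card := by
  have := Finset.card_sdiff_add_card_eq_card (openBall_subset_succ (G := G) k R)
  unfold layer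
  omega

theorem card_layer_le {R : Finset (Fin n)} (hd0 : 0 ≤ p * (n - 1)) (hε : 0 ≤ ε)
    (h : ∀ k < i, Grows G p ε k R) {k : ℕ} (hk : k ≤ i) :
    ((layer G k R).card : ℝ) ≤ R.card * ((1 + ε) * (p * (n - 1))) ^ k := by
  induction k with
  | zero => simp [layer_zero]
  | succ k ih =>
    refine (h k (by omega)).1.trans ?_
    calc (1 + ε) * (p * (n - 1) * (layer G k R).card)
        = ((1 + ε) * (p * (n - 1))) * (layer G k R).card := by ring
      _ ≤ ((1 + ε) * (p * (n - 1))) * (R.card * ((1 + ε) * (p * (n - 1))) ^ k) :=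
          mul_le_mul_of_nonneg_left (ih (by omega)) (mul_nonneg (by linarith) hd0)
      _ = _ := by ring

theorem card_openBall_le {R : Finset (Fin n)} (hd2 : 2 ≤ p * (n - 1)) (hε : 0 ≤ ε)
    (h : ∀ k < i, Grows G p ε k R) {k : ℕ} (hk : k ≤ i) :
    ((openBall G (k + 1) R).card : ℝ) ≤ 2 * R.card * ((1 + ε) * (p * (n - 1))) ^ k := by
  have hR : (0 : ℝ) ≤ R.card := by positivity
  induction k with
  | zero =>
    rw [card_openBall_succ]
    simp only [layer_zero, openBall, Finset.card_empty, zero_add, pow_zero]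
    linarith
  | succ k ih =>
    rw [card_openBall_succ]
    push_cast
    have h1 := ih (by omega)
    have h2 := card_layer_le (by linarith) hε h hk
    have ha : 2 ≤ (1 + ε) * (p * (n - 1)) := by nlinarith
    generalize (1 + ε) * (p * (n - 1)) = a at *
    have h3 : 0 ≤ (a - 2) * (R.card * a ^ k) :=
      mul_nonneg (by linarith) (mul_nonneg hR (pow_nonneg (by linarith) _))
    rw [pow_succ] at h2 ⊢
    nlinarith

theorem one_add_pow_le_two_pow (hε : 0 ≤ ε) (hε1 : ε ≤ 1) (k : ℕ) :
    (1 + ε) ^ k ≤ 1 + (2 ^ k - 1) * ε := by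
  induction k with
  | zero => simp
  | succ k ih =>
    rw [pow_succ, pow_succ]
    have h2 : (1 : ℝ) ≤ 2 ^ k := one_le_pow₀ (by norm_num)
    nlinarith [mul_le_mul_of_nonneg_right ih (by linarith : 0 ≤ 1 + ε),
      mul_nonneg (mul_nonneg (sub_nonneg.2 h2) hε) (sub_nonneg.2 hε1)]

theorem le_card_layer {R : Finset (Fin n)} (hR : R.Nonempty) (h0 : 0 ≤ p)
    (hd2 : 2 ≤ p * (n - 1)) (hε : 0 ≤ ε) (hε1 : ε ≤ 1 / 2) (h : ∀ k < i, Grows G p ε k R)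
    (hi : 2 * R.card * (2 * (p * (n - 1))) ^ i ≤ ε * n) {k : ℕ} (hk : k ≤ i) :
    R.card * ((1 - ε) ^ 3 * (p * (n - 1))) ^ k ≤ ((layer G k R).card : ℝ) := by
  have hRc : (0 : ℝ) < R.card := by exact_mod_cast hR.card_pos
  have hn2 : (2 : ℝ) ≤ n := by
    have hn : 1 ≤ n := by
      obtain ⟨x, _⟩ := hR
      exact x.pos
    rcases hn.lt_or_eq with hn | hn
    · exact_mod_cast hn
    · rw [← hn] at hd2
      norm_num at hd2
  induction k with
  | zero => simp [layer_zero]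
  | succ k ih =>
    have ih := ih (by omega)
    have hpos : (0 : ℝ) < (layer G k R).card := by
      refine lt_of_lt_of_le ?_ ih
      have : 0 < (1 - ε) ^ 3 := pow_pos (by linarith) 3
      positivity
    have hup := card_layer_le (by linarith) hε h (by omega : k ≤ i)
    have hb := card_openBall_le hd2 hε h (by omega : k ≤ i)
    have hmono : ((1 + ε) * (p * (n - 1))) ^ k ≤ (2 * (p * (n - 1))) ^ k :=
      pow_le_pow_left₀ (by nlinarith) (by nlinarith) k
    have hpow : (2 * (p * (n - 1))) ^ (k + 1) ≤ (2 * (p * (n - 1))) ^ i :=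
      pow_le_pow_right₀ (by linarith) hk
    set a := (2 * (p * (n - 1))) ^ k with ha
    have ha0 : 0 ≤ a := by positivity
    have hi' : 2 * R.card * (a * (2 * (p * (n - 1)))) ≤ ε * n := by
      refine le_trans (mul_le_mul_of_nonneg_left ?_ (by positivity)) hi
      rw [← pow_succ]
      exact hpow
    have hRa : 0 ≤ R.card * a := by positivity
    have hlay : ((layer G k R).card : ℝ) ≤ R.card * a :=
      hup.trans (mul_le_mul_of_nonneg_left hmono hRc.le)
    have h3 := (h k (by omega)).2 (Finset.card_pos.1 (by exact_mod_cast hpos)) ?_ ?_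
    · refine le_trans ?_ h3
      calc R.card * ((1 - ε) ^ 3 * (p * (n - 1))) ^ (k + 1)
          = ((1 - ε) ^ 3 * (p * (n - 1))) * (R.card * ((1 - ε) ^ 3 * (p * (n - 1))) ^ k) := by ring
        _ ≤ ((1 - ε) ^ 3 * (p * (n - 1))) * (layer G k R).card := by
            refine mul_le_mul_of_nonneg_left ih (mul_nonneg (pow_nonneg (by linarith) 3) ?_)
            linarith
        _ = _ := by ring
    · have e1 : p * (layer G k R).card ≤ p * (R.card * a) := mul_le_mul_of_nonneg_left hlay h0
      have e2 : n * (p * (R.card * a)) ≤ n * ε := by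
        have : n * p ≤ 2 * (p * (n - 1)) := by nlinarith
        have := mul_le_mul_of_nonneg_right this hRa
        nlinarith
      have := le_of_mul_le_mul_left e2 (by linarith)
      linarith
    · refine hb.trans (le_trans ?_ hi')
      refine mul_le_mul_of_nonneg_left (hmono.trans ?_) (by positivity)
      nlinarith

/-- The balls of radius `i` have size about `m`, and two of them are almost disjoint. -/
def Typical (G : SimpleGraph (Fin n)) (i : ℕ) (θ m : ℝ) : Prop :=
  (∀ v, ((openBall G (i + 1) {v}).card : ℝ) ≤ (1 + θ) * m) ∧
    (∀ v, (1 - θ) * m ≤ ((layer G i {v}).card : ℝ)) ∧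
    ∀ v w, v ≠ w → 2 * (1 - θ) * m ≤ ((openBall G (i + 1) {v, w}).card : ℝ)

theorem typical_of_grows (h0 : 0 ≤ p) (hε : 0 ≤ ε) (hε1 : ε ≤ 1 / 2) (hi : 1 ≤ i)
    (hd : 2 ^ (i + 1) ≤ ε * (p * (n - 1))) (hin : 2 ^ (i + 2) * (p * (n - 1)) ^ i ≤ ε * n)
    (h : ∀ v w, ∀ k < i, Grows G p ε k {v, w}) :
    Typical G i ((2 ^ i + 3 * i) * ε) ((p * (n - 1)) ^ i) := by
  have h2i : (1 : ℝ) ≤ 2 ^ i := one_le_pow₀ (by norm_num)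
  have hd2 : 2 ≤ p * (n - 1) := by
    rw [pow_succ] at hd
    nlinarith
  have hdi : 0 ≤ (p * (n - 1)) ^ i := pow_nonneg (by linarith) _
  have hlow : (1 - (2 ^ i + 3 * i) * ε) ≤ ((1 - ε) ^ 3) ^ i := by
    rw [← pow_mul]
    have := one_add_mul_le_pow (a := -ε) (by linarith) (3 * i)
    push_cast at this
    rw [← sub_eq_add_neg] at this
    nlinarith
  have hlayer : ∀ R : Finset (Fin n), R.Nonempty → R.card ≤ 2 → (∀ k < i, Grows G p ε k R) →
      R.card * ((1 - (2 ^ i + 3 * i) * ε) * (p * (n - 1)) ^ i) ≤ ((layer G i R).card : ℝ) := by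
    intro R hR hR2 hg
    refine le_trans ?_ (le_card_layer hR h0 hd2 hε hε1 hg ?_ le_rfl)
    · rw [mul_pow ((1 - ε) ^ 3)]
      exact mul_le_mul_of_nonneg_left (mul_le_mul_of_nonneg_right hlow hdi) (by positivity)
    · have : (R.card : ℝ) ≤ 2 := by exact_mod_cast hR2
      refine le_trans ?_ hin
      rw [mul_pow, pow_add]
      nlinarith [mul_nonneg (by linarith : (0 : ℝ) ≤ 2 ^ i) hdi]
  have hs : ∀ v, ∀ k < i, Grows G p ε k {v} := fun v k hk => by simpa using h v v k hk
  refine ⟨fun v => ?_, fun v => ?_, fun v w hvw => ?_⟩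
  · rw [card_openBall_succ]
    push_cast
    have h1 := card_layer_le (by linarith) hε (hs v) le_rfl
    obtain ⟨j, rfl⟩ : ∃ j, i = j + 1 := ⟨i - 1, by omega⟩
    have h3 := card_openBall_le hd2 hε (hs v) (by omega : j ≤ j + 1)
    have h4 := one_add_pow_le_two_pow hε (by linarith) (j + 1)
    have h5 : (1 + ε) ^ j ≤ 2 ^ j := pow_le_pow_left₀ (by linarith) (by linarith) j
    rw [Finset.card_singleton, Nat.cast_one, mul_pow] at h1 h3
    have h6 : 0 ≤ (p * (n - 1)) ^ j := pow_nonneg (by linarith) _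
    have h7 : 2 * (1 + ε) ^ j * (p * (n - 1)) ^ j ≤ ε * (p * (n - 1)) ^ (j + 1) := by
      have e : 2 * (1 + ε) ^ j ≤ ε * (p * (n - 1)) := by
        refine le_trans ?_ hd
        rw [pow_add, pow_add]
        have : (0 : ℝ) ≤ 2 ^ j := by positivity
        linarith
      have := mul_le_mul_of_nonneg_right e h6
      rw [pow_succ]
      linarith
    have h8 := mul_le_mul_of_nonneg_right h4 hdi
    have h9 : 0 ≤ (j : ℝ) * ε * (p * (n - 1)) ^ (j + 1) := by positivity
    have h10 : 0 ≤ ε * (p * (n - 1)) ^ (j + 1) := by positivity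
    push_cast
    nlinarith
  · have := hlayer {v} (by simp) (by simp) (hs v)
    simpa using this
  · have := hlayer {v, w} (by simp) (by rw [Finset.card_pair hvw]) (h v w)
    rw [Finset.card_pair hvw] at this
    rw [card_openBall_succ]
    push_cast at this ⊢
    have h2 : (0 : ℝ) ≤ (openBall G i {v, w}).card := by positivity
    linarith

theorem gnpProb_not_typical_le (h0 : 0 ≤ p) (h1 : p ≤ 1) (hε : 0 ≤ ε) (hε1 : ε ≤ 1 / 2)
    (hi : 1 ≤ i) (hd : 2 ^ (i + 1) ≤ ε * (p * (n - 1)))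
    (hin : 2 ^ (i + 2) * (p * (n - 1)) ^ i ≤ ε * n) :
    gnpProb n p {G | ¬ Typical G i ((2 ^ i + 3 * i) * ε) ((p * (n - 1)) ^ i)} ≤
      2 * i * n ^ 2 * Real.exp (-(p * (n - 1) * ε ^ 2 / 16)) := by
  refine (gnpProb_mono h0 h1 ?_).trans ((gnpProb_exists_le h0 h1
    (Finset.univ ×ˢ Finset.univ ×ˢ Finset.range i)
    (fun j : Fin n × Fin n × ℕ => {G | ¬ Grows G p ε j.2.2 {j.1, j.2.1}})
    fun j _ => gnpProb_not_grows_le h0 h1 hε hε1 _ (by simp)).trans (le_of_eq ?_))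
  · intro G hG
    by_contra hne
    refine hG (typical_of_grows h0 hε hε1 hi hd hin fun v w k hk => ?_)
    by_contra hg
    exact hne ⟨(v, w, k), by simpa using hk, hg⟩
  · simp only [Finset.card_product, Finset.card_univ, Fintype.card_fin, Finset.card_range]
    push_cast
    ring

theorem Typical.card_inter_le (hG : Typical G i θ m) {v w : Fin n} (hvw : v ≠ w) :
    ((openBall G (i + 1) {v} ∩ openBall G (i + 1) {w}).card : ℝ) ≤ 4 * θ * m := by
  have e : openBall G (i + 1) {v} ∪ openBall G (i + 1) {w} = openBall G (i + 1) {v, w} := by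
    ext x
    rw [mem_openBall_iff_exists (R := {v, w})]
    simp
  have h := Finset.card_union_add_card_inter (openBall G (i + 1) {v}) (openBall G (i + 1) {w})
  rw [e] at h
  have h' : ((openBall G (i + 1) {v, w}).card : ℝ) +
      (openBall G (i + 1) {v} ∩ openBall G (i + 1) {w}).card =
      (openBall G (i + 1) {v}).card + (openBall G (i + 1) {w}).card := by exact_mod_cast h
  linarith [hG.1 v, hG.1 w, hG.2.2 v w hvw]

theorem Typical.le_card_privateLayer (hG : Typical G i θ m) (hθm : 0 ≤ θ * m)
    {R : Finset (Fin n)} {u : Fin n} (hu : u ∈ R) :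
    (1 - 4 * R.card * θ) * m ≤ ((privateLayer G i R u).card : ℝ) := by
  have hsub : layer G i {u} ⊆ privateLayer G i R u ∪
      (R.erase u).biUnion fun w => openBall G (i + 1) {u} ∩ openBall G (i + 1) {w} := by
    intro x hx
    rw [layer, Finset.mem_sdiff] at hx
    by_cases hw : ∃ w ∈ R.erase u, x ∈ openBall G (i + 1) {w}
    · obtain ⟨w, hw, hxw⟩ := hw
      exact Finset.mem_union_right _ (Finset.mem_biUnion.2
        ⟨w, hw, Finset.mem_inter.2 ⟨hx.1, hxw⟩⟩)
    · refine Finset.mem_union_left _ (Finset.mem_sdiff.2 ⟨Finset.mem_sdiff.2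
        ⟨mem_openBall_iff_exists.2 ⟨u, hu, hx.1⟩, fun h => ?_⟩, fun h => ?_⟩)
      · obtain ⟨w, hwR, hxw⟩ := mem_openBall_iff_exists.1 h
        by_cases hwu : w = u
        · exact hx.2 (hwu ▸ hxw)
        · exact hw ⟨w, Finset.mem_erase.2 ⟨hwu, hwR⟩, openBall_subset_succ _ _ hxw⟩
      · exact hw (mem_openBall_iff_exists.1 h)
  have h1 := (Finset.card_le_card hsub).trans ((Finset.card_union_le _ _).trans
    (Nat.add_le_add_left Finset.card_biUnion_le _))
  have h2 : ((layer G i {u}).card : ℝ) ≤ (privateLayer G i R u).card +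
      ∑ w ∈ R.erase u, ((openBall G (i + 1) {u} ∩ openBall G (i + 1) {w}).card : ℝ) := by
    exact_mod_cast h1
  have h3 : ∑ w ∈ R.erase u, ((openBall G (i + 1) {u} ∩ openBall G (i + 1) {w}).card : ℝ) ≤
      (R.erase u).card * (4 * θ * m) := by
    rw [← nsmul_eq_mul]
    exact Finset.sum_le_card_nsmul _ _ _ fun w hw =>
      hG.card_inter_le (Finset.ne_of_mem_erase hw).symm
  have h4 : ((R.erase u).card : ℝ) + 1 = R.card := by
    exact_mod_cast Finset.card_erase_add_one hu
  have h5 := hG.2.1 u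
  rw [← h4]
  nlinarith

theorem Typical.card_openBall_le (hG : Typical G i θ m) (R : Finset (Fin n)) :
    ((openBall G (i + 1) R).card : ℝ) ≤ R.card * ((1 + θ) * m) := by
  have hsub : openBall G (i + 1) R ⊆ R.biUnion fun w => openBall G (i + 1) {w} := by
    intro x hx
    exact Finset.mem_biUnion.2 (mem_openBall_iff_exists.1 hx)
  have h1 := (Finset.card_le_card hsub).trans Finset.card_biUnion_le
  have h2 : ((openBall G (i + 1) R).card : ℝ) ≤
      ∑ w ∈ R, ((openBall G (i + 1) {w}).card : ℝ) := by exact_mod_cast h1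
  rw [← nsmul_eq_mul]
  exact h2.trans (Finset.sum_le_card_nsmul _ _ _ fun w _ => hG.1 w)

theorem Typical.card_sdiff_privateLayer_le (hG : Typical G i θ m) {v w : Fin n} (hvw : v ≠ w) :
    ((layer G i {v, w} \ privateLayer G i {v, w} v).card : ℝ) ≤ (1 + θ) * m := by
  refine le_trans ?_ (hG.1 w)
  have e : ({v, w} : Finset (Fin n)).erase v = {w} := by simp [hvw]
  refine Nat.cast_le.2 (Finset.card_le_card fun x hx => ?_)
  rw [privateLayer, e, Finset.mem_sdiff, Finset.mem_sdiff] at hx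
  tauto

open Classical in
/-- The vertices whose distances to `v` and `w` differ. -/
noncomputable def separators (G : SimpleGraph (Fin n)) (v w : Fin n) : Finset (Fin n) :=
  Finset.univ.filter fun u => G.dist u v ≠ G.dist u w

theorem hits_private_subset_separators {k : ℕ} {v w : Fin n} (hvw : v ≠ w) :
    (hits G k {v, w} fun N => (N ∩ privateLayer G k {v, w} v).Nonempty ∧
      N ⊆ privateLayer G k {v, w} v) ∪ (hits G k {w, v} fun N =>
      (N ∩ privateLayer G k {w, v} w).Nonempty ∧ N ⊆ privateLayer G k {w, v} w) ⊆
    separators G v w := by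
  intro x hx
  simp only [separators, Finset.mem_filter, Finset.mem_univ, true_and]
  rw [SimpleGraph.dist_comm (u := x), SimpleGraph.dist_comm (u := x)]
  rcases Finset.mem_union.1 hx with hx | hx
  · obtain ⟨h1, h2⟩ := dist_of_mem_private_hits (by simp) (by simp) hvw hx
    rw [h1]
    exact h2.symm
  · obtain ⟨h1, h2⟩ := dist_of_mem_private_hits (by simp) (by simp) hvw.symm hx
    rw [h1]
    exact h2

theorem disjoint_hits_private {k : ℕ} {v w : Fin n} (hvw : v ≠ w) :
    Disjoint (hits G k {v, w} fun N => (N ∩ privateLayer G k {v, w} v).Nonempty ∧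
      N ⊆ privateLayer G k {v, w} v) (hits G k {w, v} fun N =>
      (N ∩ privateLayer G k {w, v} w).Nonempty ∧ N ⊆ privateLayer G k {w, v} w) := by
  rw [Finset.disjoint_left]
  intro x hx hx'
  exact (dist_of_mem_private_hits (by simp) (by simp) hvw.symm hx').2
    (dist_of_mem_private_hits (by simp) (by simp) hvw hx).1

theorem gnpProb_separators_lt_le (h0 : 0 ≤ p) (h1 : p ≤ 1) (hε : 0 ≤ ε) (hε1 : ε ≤ 1)
    (hθm : 0 ≤ θ * m) (hm : 2 * ((1 + θ) * m) ≤ ε * n) {y : ℝ} (hy0 : 0 ≤ y)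
    (hy : ∀ a b : ℕ, (1 - 8 * θ) * m ≤ a → b ≤ (1 + θ) * m →
      y ≤ (1 - (1 - p) ^ a) * (1 - p) ^ b) :
    gnpProb n p {G | Typical G i θ m ∧ ∃ v w, v ≠ w ∧
        ((separators G v w).card : ℝ) < 2 * ((1 - ε) * ((1 - ε) * n * y))} ≤
      n ^ 2 * Real.exp (-((1 - ε) * n * y * ε ^ 2 / 4)) := by
  refine (gnpProb_mono h0 h1 ?_).trans ((gnpProb_exists_le h0 h1
    (Finset.univ ×ˢ Finset.univ) (fun j : Fin n × Fin n => {G |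
      ((1 - 8 * θ) * m ≤ (privateLayer G i {j.1, j.2} j.1).card ∧
        ((layer G i {j.1, j.2} \ privateLayer G i {j.1, j.2} j.1).card : ℝ) ≤ (1 + θ) * m ∧
        ((openBall G (i + 1) {j.1, j.2}).card : ℝ) ≤ ε * n) ∧
        ((hits G i {j.1, j.2} fun N => (N ∩ privateLayer G i {j.1, j.2} j.1).Nonempty ∧
          N ⊆ privateLayer G i {j.1, j.2} j.1).card : ℝ) < (1 - ε) * ((1 - ε) * n * y)})
    fun j _ => gnpProb_private_hits_lt_le h0 h1 hε hε1 j.1 hy0 hy).trans (le_of_eq ?_))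
  · rintro G ⟨hG, v, w, hvw, hlt⟩
    have key : ∀ a b : Fin n, a ≠ b →
        (1 - 8 * θ) * m ≤ (privateLayer G i {a, b} a).card ∧
        ((layer G i {a, b} \ privateLayer G i {a, b} a).card : ℝ) ≤ (1 + θ) * m ∧
        ((openBall G (i + 1) {a, b}).card : ℝ) ≤ ε * n := by
      intro a b hab
      have e1 := hG.le_card_privateLayer hθm (R := {a, b}) (u := a) (by simp)
      have e2 := hG.card_openBall_le {a, b}
      rw [Finset.card_pair hab] at e1 e2
      push_cast at e1 e2
      exact ⟨by linarith, hG.card_sdiff_privateLayer_le hab, by linarith⟩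
    by_contra hne
    have h2 : ∀ a b : Fin n, a ≠ b → (1 - ε) * ((1 - ε) * n * y) ≤
        ((hits G i {a, b} fun N => (N ∩ privateLayer G i {a, b} a).Nonempty ∧
          N ⊆ privateLayer G i {a, b} a).card : ℝ) := by
      intro a b hab
      by_contra hlt'
      exact hne ⟨(a, b), by simp, key a b hab, not_le.1 hlt'⟩
    have h3 := Finset.card_le_card (hits_private_subset_separators (G := G) (k := i) hvw)
    rw [Finset.card_union_of_disjoint (disjoint_hits_private hvw)] at h3
    have h4 := h2 v w hvw
    have h5 := h2 w v hvw.symm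
    have h6 := (Nat.cast_le (α := ℝ)).2 h3
    push_cast at h6
    linarith
  · simp only [Finset.card_product, Finset.card_univ, Fintype.card_fin]
    push_cast
    ring

theorem gnpProb_resolves_le (h0 : 0 ≤ p) (h1 : p ≤ 1) (hθm : 0 ≤ θ * m)
    (hm : r * ((1 + θ) * m) ≤ n / 2) {y : ℝ} (hy0 : 0 ≤ y)
    (hy : ∀ a : ℕ, (1 - 4 * r * θ) * m ≤ a → y ≤ 1 - (1 - p) ^ a) (hny : 8 ≤ n * y ^ r) :
    gnpProb n p {G | Typical G i θ m ∧ ∃ R : Finset (Fin n), R.card = r ∧ Resolves G R} ≤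
      n ^ r * Real.exp (-(n * y ^ r / 32)) := by
  refine (gnpProb_mono h0 h1 ?_).trans ((gnpProb_exists_le h0 h1
    (Finset.powersetCard r Finset.univ) (fun R : Finset (Fin n) => {G |
      ((∀ u ∈ R, (1 - 4 * r * θ) * m ≤ (privateLayer G i R u).card) ∧
        ((openBall G (i + 1) R).card : ℝ) ≤ n / 2) ∧
        ((hits G i R fun N => ∀ u ∈ R, (N ∩ privateLayer G i R u).Nonempty).card : ℝ) <
          (1 - 1 / 2) * (n / 2 * y ^ R.card)})
    (η := Real.exp (-(n * y ^ r / 32))) fun R hR => ?_).trans ?_)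
  · rintro G ⟨hG, R, hR, hres⟩
    refine ⟨R, by simp [hR], ⟨fun u hu => ?_, ?_⟩, ?_⟩
    · rw [← hR]
      exact hG.le_card_privateLayer hθm hu
    · refine (hG.card_openBall_le R).trans ?_
      rw [hR]
      exact hm
    · by_contra hge
      rw [hR] at hge
      have h2 : 1 < (hits G i R fun N => ∀ u ∈ R, (N ∩ privateLayer G i R u).Nonempty).card := by
        have : (1 : ℝ) <
            (hits G i R fun N => ∀ u ∈ R, (N ∩ privateLayer G i R u).Nonempty).card := by
          linarith
        exact_mod_cast this
      obtain ⟨x, hx, x', hx', hne⟩ := Finset.one_lt_card.1 h2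
      obtain ⟨u, hu, hd⟩ := hres hne
      exact hd ((dist_of_mem_common_hits hx u hu).trans (dist_of_mem_common_hits hx' u hu).symm)
  · have := gnpProb_common_hits_lt_le (R := R) (k := i) h0 h1 hy0 hy
    rw [(Finset.mem_powersetCard.1 hR).2] at this ⊢
    exact this.trans (Real.exp_le_exp.2 (by linarith))
  · gcongr
    rw [Finset.card_powersetCard, Finset.card_univ, Fintype.card_fin]
    exact_mod_cast Nat.choose_le_pow n r

end Growth

section MetricDimension

variable {n r : ℕ} {G : SimpleGraph (Fin n)} {γ : ℝ}

theorem Resolves.mono {V : Type*} {G : SimpleGraph V} {R R' : Set V} (h : Resolves G R)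
    (hR : R ⊆ R') : Resolves G R' := fun _ _ hvw => by
  obtain ⟨u, hu, hd⟩ := h hvw
  exact ⟨u, hR hu, hd⟩

theorem exists_resolves_of_separators (hn : 1 ≤ n)
    (h : ∀ v w, v ≠ w → γ * n ≤ ((separators G v w).card : ℝ))
    (hr : (n : ℝ) ^ 2 * (1 - γ) ^ r < 1) :
    ∃ R : Set (Fin n), R.ncard ≤ r ∧ Resolves G R := by
  classical
  by_contra hne
  push Not at hne
  have hcover : (Finset.univ : Finset (Fin r → Fin n)) ⊆
      ((Finset.univ ×ˢ Finset.univ).filter fun e : Fin n × Fin n => e.1 ≠ e.2).biUnion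
        fun e => Fintype.piFinset fun _ => Finset.univ \ separators G e.1 e.2 := by
    intro f _
    have hf := hne (Set.range f) ((Set.ncard_le_ncard
      (by simp : Set.range f ⊆ ((Finset.univ.image f : Finset (Fin n)) : Set (Fin n)))).trans ?_)
    · unfold Resolves at hf
      push Not at hf
      obtain ⟨v, w, hvw, hf⟩ := hf
      refine Finset.mem_biUnion.2 ⟨(v, w), by simpa using hvw, Fintype.mem_piFinset.2 fun j => ?_⟩
      have := hf (f j) ⟨j, rfl⟩
      simpa [separators] using this
    · rw [Set.ncard_coe_finset]
      exact Finset.card_image_le.trans (by simp)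
  have h1 := (Finset.card_le_card hcover).trans Finset.card_biUnion_le
  have h2 : (n : ℝ) ^ r ≤ ∑ e ∈ (Finset.univ ×ˢ Finset.univ).filter
      fun e : Fin n × Fin n => e.1 ≠ e.2,
      ((Fintype.piFinset fun _ : Fin r => Finset.univ \ separators G e.1 e.2).card : ℝ) := by
    have := (Nat.cast_le (α := ℝ)).2 h1
    simpa using this
  have hn0 : (0 : ℝ) < n := by exact_mod_cast hn
  have h3 : ∀ e ∈ (Finset.univ ×ˢ Finset.univ).filter fun e : Fin n × Fin n => e.1 ≠ e.2,
      ((Fintype.piFinset fun _ : Fin r => Finset.univ \ separators G e.1 e.2).card : ℝ) ≤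
        ((1 - γ) * n) ^ r := by
    intro e he
    rw [Fintype.card_piFinset_const, Nat.cast_pow]
    refine pow_le_pow_left₀ (by positivity) ?_ _
    rw [Finset.cast_card_sdiff (Finset.subset_univ _)]
    have := h e.1 e.2 (Finset.mem_filter.1 he).2
    simp only [Finset.card_univ, Fintype.card_fin]
    linarith
  by_cases hγ : γ ≤ 1
  · have h4 := h2.trans (Finset.sum_le_card_nsmul _ _ _ h3)
    have h5 : (((Finset.univ ×ˢ Finset.univ).filter
        fun e : Fin n × Fin n => e.1 ≠ e.2).card : ℝ) ≤ n ^ 2 := by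
      have := Finset.card_filter_le (Finset.univ ×ˢ Finset.univ)
        (fun e : Fin n × Fin n => e.1 ≠ e.2)
      simp only [Finset.card_product, Finset.card_univ, Fintype.card_fin] at this
      rw [sq]
      exact_mod_cast this
    have h6 : (0 : ℝ) ≤ (1 - γ) ^ r := pow_nonneg (by linarith) _
    rw [nsmul_eq_mul, mul_pow] at h4
    have h7 : (0 : ℝ) < n ^ r := by positivity
    have h8 := mul_le_mul_of_nonneg_right h5 (mul_nonneg h6 h7.le)
    have h9 := mul_lt_mul_of_pos_right hr h7
    linarith
  · have h10 : ∀ v w : Fin n, v = w := by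
      intro v w
      by_contra hvw
      have h11 := h v w hvw
      have h12 := Finset.card_le_univ (separators G v w)
      rw [Fintype.card_fin] at h12
      have h13 : ((separators G v w).card : ℝ) ≤ n := by exact_mod_cast h12
      nlinarith
    exact hne ∅ (by simp) fun v w hvw => absurd (h10 v w) hvw

theorem metricDim_le_of_resolves {R : Set (Fin n)} (hR : Resolves G R) (hr : R.ncard ≤ r) :
    metricDim G ≤ r := by
  refine le_trans ?_ hr
  unfold metricDim
  exact Nat.sInf_le ⟨R, R.toFinite, rfl, hR⟩

theorem lt_metricDim_of_forall_not_resolves {R₀ : Set (Fin n)} (hR₀ : Resolves G R₀) (hr : r ≤ n)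
    (h : ∀ R : Finset (Fin n), R.card = r → ¬ Resolves G R) : r < metricDim G := by
  classical
  by_contra! hle
  obtain ⟨R, hfin, hcard, hR⟩ := Nat.sInf_mem
    (s := {k : ℕ | ∃ R : Set (Fin n), R.Finite ∧ R.ncard = k ∧ Resolves G R})
    ⟨_, R₀, R₀.toFinite, rfl, hR₀⟩
  have h1 : hfin.toFinset.card ≤ r := by
    rw [← Set.ncard_eq_toFinset_card R hfin, hcard]
    exact hle
  obtain ⟨R', hR', hR'c⟩ := Finset.exists_superset_card_eq h1 (by simpa using hr)
  refine h R' hR'c (hR.mono fun x hx => ?_)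
  exact hR' (hfin.mem_toFinset.2 hx)

end MetricDimension

section Estimates

variable {n i : ℕ} {p c δ η θ m L : ℝ}

theorem exp_le_one_sub {x : ℝ} (h0 : 0 ≤ x) (h1 : x ≤ 1 / 2) :
    Real.exp (-(x * (1 + 2 * x))) ≤ 1 - x := by
  rw [Real.exp_neg]
  have h2 := Real.add_one_le_exp (x * (1 + 2 * x))
  rw [inv_le_comm₀ (Real.exp_pos _) (by linarith)]
  refine le_trans ?_ h2
  rw [inv_le_iff_one_le_mul₀ (by linarith)]
  nlinarith [mul_nonneg (mul_nonneg h0 h0) (by linarith : 0 ≤ 1 - 2 * x)]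

theorem exp_le_one_sub_pow {x : ℝ} (h0 : 0 ≤ x) (h1 : x ≤ 1 / 2) (t : ℕ) :
    Real.exp (-(t * x * (1 + 2 * x))) ≤ (1 - x) ^ t := by
  have e : -(t * x * (1 + 2 * x)) = t * -(x * (1 + 2 * x)) := by ring
  rw [e, Real.exp_nat_mul]
  exact pow_le_pow_left₀ (Real.exp_pos _).le (exp_le_one_sub h0 h1) t

theorem le_private_prob (h0 : 0 ≤ p) (h1 : p ≤ 1 / 2) (hθ1 : 16 * θ ≤ 1) (hc0 : 0 ≤ c)
    (hcm : c ≤ p * m) (hmc : p * m * (1 + θ) * (1 + 2 * p) ≤ c + η) (hη : Real.exp (-(c / 2)) ≤ η)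
    (hη1 : η ≤ 1) {a b : ℕ} (ha : (1 - 8 * θ) * m ≤ a) (hb : b ≤ (1 + θ) * m) :
    (1 - 2 * η) * Real.exp (-c) ≤ (1 - (1 - p) ^ a) * (1 - p) ^ b := by
  have h2 : (1 - p) ^ a ≤ η := by
    refine (one_sub_pow_le_exp (by linarith) a).trans (le_trans (Real.exp_le_exp.2 ?_) hη)
    have := mul_le_mul_of_nonneg_left ha h0
    nlinarith
  have h3 : (1 - η) * Real.exp (-c) ≤ (1 - p) ^ b := by
    refine le_trans ?_ (exp_le_one_sub_pow h0 h1 b)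
    have h4 : Real.exp (-(c + η)) ≤ Real.exp (-(b * p * (1 + 2 * p))) := by
      refine Real.exp_le_exp.2 (neg_le_neg (le_trans ?_ hmc))
      have := mul_le_mul_of_nonneg_right hb (mul_nonneg h0 (by linarith : 0 ≤ 1 + 2 * p))
      nlinarith
    refine le_trans ?_ h4
    rw [neg_add, Real.exp_add, mul_comm]
    refine mul_le_mul_of_nonneg_left ?_ (Real.exp_pos _).le
    have := Real.add_one_le_exp (-η)
    linarith
  have h5 := Real.exp_pos (-c)
  have h6 := Real.exp_pos (-(c / 2))
  calc (1 - 2 * η) * Real.exp (-c) ≤ (1 - η) * ((1 - η) * Real.exp (-c)) := by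
        nlinarith [mul_nonneg (sq_nonneg η) h5.le]
    _ ≤ (1 - (1 - p) ^ a) * (1 - p) ^ b :=
        mul_le_mul (by linarith) h3 (mul_nonneg (by linarith) h5.le) (by linarith)

theorem exp_sub_le (hη0 : 0 ≤ η) (hη1 : η ≤ 1 / 16) (hη : Real.exp (-(c / 2)) ≤ η) :
    Real.exp (η - c) ≤ η := by
  have e : Real.exp (η - c) = Real.exp η * (Real.exp (-(c / 2)) * Real.exp (-(c / 2))) := by
    rw [← Real.exp_add, ← Real.exp_add]
    congr 1
    ring
  have h1 : Real.exp η ≤ 3 := by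
    refine (Real.exp_le_exp.2 (by linarith : η ≤ 1)).trans ?_
    linarith [Real.exp_one_lt_d9]
  have h2 := Real.exp_pos (-(c / 2))
  have h3 : Real.exp (-(c / 2)) * Real.exp (-(c / 2)) ≤ η * η := mul_le_mul hη hη h2.le hη0
  rw [e]
  calc _ ≤ 3 * (η * η) := mul_le_mul h1 h3 (by positivity) (by norm_num)
    _ ≤ η := by nlinarith

theorem le_common_pow (hδ0 : 0 < δ) (hδ1 : δ < 1) (hη : Real.exp (-(c / 2)) ≤ δ / 16)
    (hL : 0 ≤ L) {r : ℕ} (hr : r ≤ (1 - δ) * (Real.exp c * L)) :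
    Real.exp (-((1 - δ / 2) * L)) ≤ (1 - Real.exp (δ / 16 - c)) ^ r := by
  have h1 := exp_sub_le (by linarith) (by linarith) hη
  have h2 := Real.exp_pos (δ / 16 - c)
  refine le_trans (Real.exp_le_exp.2 (neg_le_neg ?_)) (exp_le_one_sub_pow h2.le (by linarith) r)
  have h3 : Real.exp (δ / 16) ≤ 1 + δ / 8 := by
    have := (abs_le.1 (Real.abs_exp_sub_one_sub_id_le (x := δ / 16)
      (by rw [abs_le]; constructor <;> linarith))).2
    nlinarith
  have h4 : (r : ℝ) * Real.exp (δ / 16 - c) ≤ (1 - δ) * L * (1 + δ / 8) := by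
    calc (r : ℝ) * Real.exp (δ / 16 - c)
        ≤ (1 - δ) * (Real.exp c * L) * Real.exp (δ / 16 - c) :=
          mul_le_mul_of_nonneg_right hr h2.le
      _ = (1 - δ) * L * (Real.exp c * Real.exp (δ / 16 - c)) := by ring
      _ = (1 - δ) * L * Real.exp (δ / 16) := by
          rw [← Real.exp_add]
          congr 2
          ring
      _ ≤ _ := mul_le_mul_of_nonneg_left h3 (mul_nonneg (by linarith) hL)
  have h5 : 0 ≤ (1 - δ) * L * (1 + δ / 8) :=
    mul_nonneg (mul_nonneg (by linarith) hL) (by linarith)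
  calc (r : ℝ) * Real.exp (δ / 16 - c) * (1 + 2 * Real.exp (δ / 16 - c))
      ≤ (1 - δ) * L * (1 + δ / 8) * (1 + δ / 8) :=
        mul_le_mul h4 (by linarith) (by linarith) h5
    _ = ((1 - δ) * (1 + δ / 8) * (1 + δ / 8)) * L := by ring
    _ ≤ (1 - δ / 2) * L := by
        refine mul_le_mul_of_nonneg_right ?_ hL
        nlinarith [mul_pos hδ0 hδ0, mul_pos (mul_pos hδ0 hδ0) hδ0]

end Estimates

section FiniteBound

variable {n i : ℕ} {p c δ ε θ m L y z : ℝ}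

theorem gnpProb_not_metricDim_between_le (h0 : 0 ≤ p) (h1 : p ≤ 1) (hn : 1 ≤ n) {r₀ r₁ : ℕ}
    {t₁ t₂ t₃ : ℝ} (hT : gnpProb n p {G | ¬ Typical G i θ m} ≤ t₁)
    (hS : gnpProb n p {G | Typical G i θ m ∧ ∃ v w, v ≠ w ∧
      ((separators G v w).card : ℝ) < z * n} ≤ t₂)
    (hR : gnpProb n p {G | Typical G i θ m ∧ ∃ R : Finset (Fin n), R.card = r₀ ∧ Resolves G R} ≤ t₃)
    (hr₀ : r₀ ≤ n) (hr₁ : (n : ℝ) ^ 2 * (1 - z) ^ r₁ < 1) :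
    gnpProb n p {G | ¬ (r₀ < metricDim G ∧ metricDim G ≤ r₁)} ≤ t₁ + t₂ + t₃ := by
  refine (gnpProb_mono h0 h1 ?_).trans ((gnpProb_union_le h0 h1 _ _).trans
    (add_le_add ((gnpProb_union_le h0 h1 _ _).trans (add_le_add hT hS)) hR))
  intro G hG
  by_contra h
  simp only [Set.mem_union, Set.mem_ofPred_eq, not_or, not_not, not_and] at h
  obtain ⟨⟨hG1, hG2⟩, hG3⟩ := h
  have hsep : ∀ v w, v ≠ w → z * n ≤ ((separators G v w).card : ℝ) := by
    intro v w hvw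
    by_contra hlt
    exact hG2 hG1 ⟨v, w, hvw, not_le.1 hlt⟩
  obtain ⟨R, hRc, hres⟩ := exists_resolves_of_separators hn hsep hr₁
  exact hG ⟨lt_metricDim_of_forall_not_resolves hres hr₀ fun R' hR' hres' =>
    hG3 hG1 ⟨R', hR', hres'⟩, metricDim_le_of_resolves hres hRc⟩

/-- Consequences for the sizes of balls of the choice of scale `ε = L⁻⁴`, where `L = log n`. -/
theorem exists_scale {n K : ℝ} (h0 : 0 ≤ p) (h1 : p ≤ 1) (hn1 : 1 ≤ n) (hi : 1 ≤ i)
    (hL7 : 7000 ≤ L) (hδ0 : 0 < δ) (hδ1 : δ < 1) (hδL : 7000 ≤ δ * L) (hK0 : 0 ≤ K)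
    (hKδ : K * 1000 ≤ δ * L) (h2iL : (2 : ℝ) ^ (i + 2) ≤ L) (hdL : L ^ 20 ≤ p * (n - 1))
    (hc : (p * (n - 1)) ^ (i + 1) = c * n) (hc0 : 0 ≤ c) (hcL : c ≤ L) :
    ∃ ε, 0 ≤ ε ∧ ε ≤ δ / 7000 ∧ ε * L ^ 4 = 1 ∧ K * ε ≤ δ / 7000 ∧ K * ε * L ^ 3 * 1000 ≤ δ ∧
      p ≤ δ / 7000 ∧ c ≤ p * (p * (n - 1)) ^ i ∧
      p * (p * (n - 1)) ^ i * (1 + K * ε) * (1 + 2 * p) ≤ c + δ / 16 ∧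
      2 ^ (i + 2) * (p * (n - 1)) ^ i ≤ ε * n ∧ L ^ 12 ≤ p * (n - 1) * ε ^ 2 ∧
      2 ^ (i + 1) ≤ ε * (p * (n - 1)) := by
  have hL1 : 1 ≤ L := by linarith
  have hL0 : 0 < L := by linarith
  have hpow : ∀ {a b : ℕ}, a ≤ b → L ^ a ≤ L ^ b := fun h => pow_le_pow_right₀ hL1 h
  have hd1 : 1 ≤ p * (n - 1) := (one_le_pow₀ hL1).trans hdL
  have hnd : L ^ 20 ≤ n - 1 := hdL.trans (mul_le_of_le_one_left (by linarith) h1)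
  set d := p * (n - 1) with hd
  set M := d ^ i with hM
  have hMd : M * d = c * n := by rw [hM, ← pow_succ, hc]
  have hM0 : 0 ≤ M := by positivity
  have hML : M * L ^ 19 ≤ n := by
    have h2 := mul_le_mul_of_nonneg_left hdL hM0
    have h3 : c * n ≤ L * n := mul_le_mul_of_nonneg_right hcL (by linarith)
    have h4 : L * (M * L ^ 19) ≤ L * n := by
      calc L * (M * L ^ 19) = M * L ^ 20 := by ring
        _ ≤ L * n := by linarith
    exact le_of_mul_le_mul_left h4 hL0
  have hdM : d ≤ M := by
    rw [hM]
    exact le_self_pow₀ hd1 (by omega)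
  have hpL : p * L ^ 19 ≤ 2 := by
    have h2 : p * n ≤ 2 * d := by linarith
    have h3 : d * L ^ 19 ≤ n :=
      (mul_le_mul_of_nonneg_right hdM (by positivity)).trans hML
    have h4 : n * (p * L ^ 19) ≤ n * 2 := by
      have := mul_le_mul_of_nonneg_right h2 (by positivity : 0 ≤ L ^ 19)
      linarith
    exact le_of_mul_le_mul_left h4 (by linarith)
  have hp3 : p * L ^ 3 ≤ 1 := by
    have h2 : p * L ^ 3 * 2 ≤ p * L ^ 3 * L ^ 16 := by
      refine mul_le_mul_of_nonneg_left ?_ (by positivity)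
      have := hpow (by norm_num : 1 ≤ 16)
      rw [pow_one] at this
      linarith
    have h3 : p * L ^ 3 * L ^ 16 = p * L ^ 19 := by ring
    linarith
  obtain ⟨ε, hε⟩ : ∃ ε, ε = 1 / L ^ 4 := ⟨_, rfl⟩
  have hεL : ε * L ^ 4 = 1 := by
    rw [hε]
    field_simp
  have hε0 : 0 ≤ ε := by rw [hε]; positivity
  obtain ⟨s, hs⟩ : ∃ s, s = 1 / L ^ 3 := ⟨_, rfl⟩
  have hsL : s * L ^ 3 = 1 := by
    rw [hs]
    field_simp
  have hs0 : 0 ≤ s := by rw [hs]; positivity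
  have hL3 : (0 : ℝ) < L ^ 3 := by positivity
  have hεs : ε * L = s := by
    have : (ε * L) * L ^ 3 = s * L ^ 3 := by
      rw [hsL, ← hεL]
      ring
    exact mul_right_cancel₀ hL3.ne' this
  have hps : p ≤ s := by
    refine le_of_mul_le_mul_right ?_ hL3
    linarith
  have hsL2 : s * L * L ≤ δ / 7000 := by
    have h2 : (s * L * L) * L ≤ δ / 7000 * L := by
      calc (s * L * L) * L = s * L ^ 3 := by ring
        _ ≤ _ := by linarith
    exact le_of_mul_le_mul_right h2 hL0
  have hsLs : s * L ≤ δ / 7000 :=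
    (le_mul_of_one_le_right (mul_nonneg hs0 hL0.le) hL1).trans hsL2
  have hss : s ≤ δ / 7000 := (le_mul_of_one_le_right hs0 hL1).trans hsLs
  have hθs : 1000 * (K * ε) ≤ s := by
    rw [← hεs]
    linarith only [mul_le_mul_of_nonneg_left hKδ hε0,
      mul_le_mul_of_nonneg_left hδ1.le (mul_nonneg hε0 hL0.le)]
  have hεs1 : ε ≤ s := by
    rw [← hεs]
    exact le_mul_of_one_le_right hε0 hL1
  have hθ0 : 0 ≤ K * ε := by positivity
  have hpm : (p * M - c) * (n - 1) = c := by
    have : p * M * (n - 1) = M * d := by rw [hd]; ring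
    rw [sub_mul, this, hMd]
    ring
  have hn2 : 0 < n - 1 := lt_of_lt_of_le (by positivity) hnd
  have hcm : c ≤ p * M := by
    by_contra hlt
    linarith only [mul_neg_of_neg_of_pos (sub_neg.2 (not_le.1 hlt)) hn2, hpm, hc0]
  have hmc : p * M ≤ c * (1 + s) := by
    have h2 : (p * M - c) * L ^ 3 ≤ c * s * L ^ 3 := by
      calc (p * M - c) * L ^ 3 ≤ (p * M - c) * (n - 1) :=
            mul_le_mul_of_nonneg_left ((hpow (by norm_num)).trans hnd) (by linarith)
        _ = c * s * L ^ 3 := by rw [hpm, mul_assoc, hsL, mul_one]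
    have := le_of_mul_le_mul_right h2 hL3
    linarith
  have hmc' : p * M * (1 + K * ε) * (1 + 2 * p) ≤ c + δ / 16 := by
    calc p * M * (1 + K * ε) * (1 + 2 * p) ≤ c * (1 + s) * (1 + s) * (1 + 2 * s) := by
          gcongr
          linarith
      _ = c * ((1 + s) * (1 + s) * (1 + 2 * s)) := by ring
      _ ≤ c * (1 + 11 * s) := by
          refine mul_le_mul_of_nonneg_left ?_ hc0
          have : s ≤ 1 := by linarith
          nlinarith only [hs0, this, mul_nonneg hs0 hs0, mul_nonneg hs0 (sub_nonneg.2 this),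
            mul_nonneg (mul_nonneg hs0 hs0) (sub_nonneg.2 this)]
      _ ≤ c + δ / 16 := by linarith only [mul_le_mul_of_nonneg_right hcL hs0, hsLs, hδ0]
  have hin : 2 ^ (i + 2) * M ≤ ε * n := by
    have h2 : (2 ^ (i + 2) * M) * L ^ 4 ≤ (ε * n) * L ^ 4 := by
      calc (2 ^ (i + 2) * M) * L ^ 4 ≤ (L * M) * L ^ 4 := by gcongr
        _ = M * L ^ 5 := by ring
        _ ≤ M * L ^ 19 := mul_le_mul_of_nonneg_left (hpow (by norm_num)) hM0
        _ ≤ n := hML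
        _ = (ε * n) * L ^ 4 := by rw [mul_right_comm, hεL, one_mul]
    exact le_of_mul_le_mul_right h2 (by positivity)
  have hεd : L ^ 12 ≤ d * ε ^ 2 := by
    calc L ^ 12 = L ^ 12 * (ε * L ^ 4) ^ 2 := by rw [hεL]; ring
      _ = L ^ 20 * ε ^ 2 := by ring
      _ ≤ _ := mul_le_mul_of_nonneg_right hdL (sq_nonneg _)
  have hεd1 : 2 ^ (i + 1) ≤ ε * d := by
    calc (2 : ℝ) ^ (i + 1) ≤ 2 ^ (i + 2) := pow_le_pow_right₀ (by norm_num) (by omega)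
      _ ≤ L := h2iL
      _ ≤ L ^ 12 := le_self_pow₀ hL1 (by norm_num)
      _ ≤ d * ε ^ 2 := hεd
      _ = (ε * d) * ε := by ring
      _ ≤ ε * d := mul_le_of_le_one_right (by positivity) (by linarith)
  have hKs : K * ε * L ^ 3 * 1000 ≤ δ := by
    calc K * ε * L ^ 3 * 1000 = K * 1000 * (ε * L ^ 3) := by ring
      _ ≤ δ * L * (ε * L ^ 3) := mul_le_mul_of_nonneg_right hKδ (by positivity)
      _ = δ * (ε * L ^ 4) := by ring
      _ = δ := by rw [hεL, mul_one]
  exact ⟨ε, hε0, by linarith, hεL, by linarith, hKs, by linarith, hcm, hmc', hin, hεd, hεd1⟩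

theorem three_mul_le_of_le {n E : ℝ} (hδ0 : 0 < δ) (hδ1 : δ < 1) (hδL : 7000 ≤ δ * L)
    (hL7 : 7000 ≤ L) (hnL : L ^ 4 ≤ n) (hE : 1 ≤ E * L) (hyl : 7 / 8 * E ≤ y) :
    3 * L ≤ (1 - δ / 8) * n * y * (δ / 8) ^ 2 / 4 := by
  have hL3 : 0 < L ^ 3 := by positivity
  have h3 : 7 / 8 * (7 / 8) ≤ (1 - δ / 8) * (y * L) := by
    refine mul_le_mul (by linarith) ?_ (by norm_num) (by linarith)
    nlinarith
  have h4 : (49000000 : ℝ) ≤ (δ * L) ^ 2 := by nlinarith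
  have h5 : 7 / 8 * (7 / 8) * 49000000 ≤ (1 - δ / 8) * (y * L) * (δ * L) ^ 2 :=
    mul_le_mul h3 h4 (by norm_num) (le_trans (by norm_num) h3)
  have h6 : L * L ^ 3 * (7 / 8 * (7 / 8) * 49000000) ≤
      n * ((1 - δ / 8) * (y * L) * (δ * L) ^ 2) := by
    refine mul_le_mul ?_ h5 (by norm_num) (le_trans (by positivity) hnL)
    linarith
  have h7 : L ^ 3 * (L * (7 / 8 * (7 / 8) * 49000000)) ≤
      L ^ 3 * (n * ((1 - δ / 8) * y * δ ^ 2)) := by linarith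
  have h8 := le_of_mul_le_mul_left h7 hL3
  linarith

theorem two_mul_lt_of_le {r E : ℝ} (hδ0 : 0 < δ) (hδ1 : δ < 1) (hδL : 7000 ≤ δ * L)
    (hL0 : 0 < L) (hr : 0 ≤ r) (hE1 : 0 < E) (hE3 : E ≤ 1 / 256)
    (hexp : E * Real.exp c = 1) (hr₁lt : (1 + δ) * (Real.exp c * L) < r + 1)
    (hy : y = (1 - 2 * (δ / 16)) * E) :
    2 * L < 2 * ((1 - δ / 8) * ((1 - δ / 8) * y)) * r := by
  have h2 : (1 - 3 * δ / 8) * E ≤ (1 - δ / 8) * ((1 - δ / 8) * y) := by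
    rw [hy, ← mul_assoc, ← mul_assoc]
    refine mul_le_mul_of_nonneg_right ?_ hE1.le
    nlinarith [mul_pos hδ0 hδ0, mul_nonneg (mul_pos hδ0 hδ0).le (sub_nonneg.2 hδ1.le)]
  have h3 : (1 + δ) * (Real.exp c * L) - 1 ≤ r := by linarith
  have h4 : (1 - 3 * δ / 8) * E * ((1 + δ) * (Real.exp c * L) - 1) ≤
      (1 - δ / 8) * ((1 - δ / 8) * y) * r :=
    (mul_le_mul_of_nonneg_left h3 (mul_nonneg (by linarith) hE1.le)).trans
      (mul_le_mul_of_nonneg_right h2 (by positivity))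
  have h5 : (1 - 3 * δ / 8) * E * ((1 + δ) * (Real.exp c * L) - 1) =
      (1 - 3 * δ / 8) * (1 + δ) * L * (E * Real.exp c) -
        (1 - 3 * δ / 8) * E := by ring
  have h6 : (1 + δ / 4) * L ≤ (1 - 3 * δ / 8) * (1 + δ) * L := by
    refine mul_le_mul_of_nonneg_right ?_ hL0.le
    nlinarith
  have h7 : (1 - 3 * δ / 8) * E ≤ 1 := by nlinarith
  rw [hexp] at h5
  linarith

theorem gnpProb_metricDim_not_mem_le (h0 : 0 ≤ p) (h1 : p ≤ 1) (hn : 1 ≤ n) (hi : 1 ≤ i)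
    (hL : L = Real.log n) (hδ0 : 0 < δ) (hδ1 : δ < 1)
    (hLB : 1000 * (2 ^ (i + 2) + 3 * i) ≤ δ * L) (hdL : L ^ 20 ≤ p * (n - 1))
    (hc : (p * (n - 1)) ^ (i + 1) = c * n) (hc0 : 0 ≤ c) (hec : Real.exp c ≤ L)
    (hη : Real.exp (-(c / 2)) ≤ δ / 16)
    (hE : 32 * (L ^ 3 + L) + 8 ≤ Real.exp (δ / 2 * L)) :
    gnpProb n p {G | ¬ ((1 - δ) * (Real.exp c * L) ≤ metricDim G ∧
      metricDim G ≤ (1 + δ) * (Real.exp c * L))} ≤ (2 * i + 2) * Real.exp (-L) := by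
  have hN : (n : ℝ) = Real.exp L := by
    rw [hL, Real.exp_log (by exact_mod_cast hn)]
  have hn1 : (1 : ℝ) ≤ n := by exact_mod_cast hn
  have h2i : (1 : ℝ) ≤ 2 ^ i := one_le_pow₀ (by norm_num)
  have hi1 : (1 : ℝ) ≤ i := by exact_mod_cast hi
  have h2i2 : (2 : ℝ) ^ (i + 2) = 4 * 2 ^ i := by ring
  have hδL : 7000 ≤ δ * L := by linarith
  have hL0 : 0 < L := by
    by_contra h
    nlinarith only [h, hδL, hδ0]
  have hδLL : δ * L ≤ L := mul_le_of_le_one_left hL0.le hδ1.le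
  have hL7 : 7000 ≤ L := hδL.trans hδLL
  have hL1 : 1 ≤ L := by linarith
  have hKδ : (2 ^ i + 3 * i : ℝ) * 1000 ≤ δ * L := by linarith
  have h2iL : (2 : ℝ) ^ (i + 2) ≤ L := by linarith
  have hcL : c ≤ L := by linarith [Real.add_one_le_exp c]
  generalize hK : (2 ^ i + 3 * i : ℝ) = K at *
  have hK0 : 0 ≤ K := by rw [← hK]; positivity
  have hpow : ∀ {a b : ℕ}, a ≤ b → L ^ a ≤ L ^ b := fun h => pow_le_pow_right₀ hL1 h
  have hd1 : 1 ≤ p * (n - 1) := (one_le_pow₀ hL1).trans hdL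
  have hnd : L ^ 20 ≤ n - 1 := hdL.trans (mul_le_of_le_one_left (by linarith) h1)
  set d := p * ((n : ℝ) - 1) with hd
  set M := d ^ i with hM
  obtain ⟨ε, hε0, hεδ, hεL, hθδ, hKs, hpδ, hcm, hmc', hin, hεd, hεd1⟩ :=
    exists_scale h0 h1 hn1 hi hL7 hδ0 hδ1 hδL hK0 hKδ h2iL hdL hc hc0 hcL
  rw [← hd] at hcm hmc' hin hεd hεd1
  rw [← hM] at hcm hmc' hin
  have hM0 : 0 ≤ M := by positivity
  have hL3 : (0 : ℝ) < L ^ 3 := by positivity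
  have hθ0 : 0 ≤ K * ε := by positivity
  have h4M : 4 * M ≤ ε * n := by
    refine le_trans ?_ hin
    refine mul_le_mul_of_nonneg_right ?_ hM0
    linarith
  have hexp : Real.exp (-c) * Real.exp c = 1 := by
    rw [← Real.exp_add]
    simp
  have hE0 := Real.exp_pos c
  have hE1 := Real.exp_pos (-c)
  have hE2 : 1 ≤ Real.exp (-c) * L := by
    rw [← hexp]
    gcongr
  have hE3 : Real.exp (-c) ≤ 1 / 256 := by
    have h2 : Real.exp (-c) = Real.exp (-(c / 2)) * Real.exp (-(c / 2)) := by
      rw [← Real.exp_add]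
      congr 1
      ring
    have h3 : Real.exp (-(c / 2)) ≤ 1 / 16 := by linarith
    rw [h2]
    exact (mul_le_mul h3 h3 (Real.exp_pos _).le (by norm_num)).trans (by norm_num)
  have hecL : Real.exp c * L ≤ L ^ 2 := by
    rw [sq]
    exact mul_le_mul_of_nonneg_right hec hL0.le
  have hecL0 : 0 ≤ Real.exp c * L := by positivity
  set r₀ := ⌊(1 - δ) * (Real.exp c * L)⌋₊ with hr₀
  set r₁ := ⌊(1 + δ) * (Real.exp c * L)⌋₊ with hr₁
  have hr₀le : (r₀ : ℝ) ≤ (1 - δ) * (Real.exp c * L) :=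
    Nat.floor_le (mul_nonneg (by linarith) hecL0)
  have hr₀L : (r₀ : ℝ) ≤ L ^ 2 :=
    hr₀le.trans ((mul_le_of_le_one_left hecL0 (by linarith)).trans hecL)
  have hr₁le : (r₁ : ℝ) ≤ (1 + δ) * (Real.exp c * L) :=
    Nat.floor_le (mul_nonneg (by linarith) hecL0)
  have hr₁lt : (1 + δ) * (Real.exp c * L) < r₁ + 1 := Nat.lt_floor_add_one _
  have hrn : r₀ ≤ n := by
    have h2 : (r₀ : ℝ) ≤ n := by linarith [hpow (by norm_num : 2 ≤ 20)]
    exact_mod_cast h2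
  have hT := gnpProb_not_typical_le (i := i) h0 h1 hε0 (by linarith) hi (by rwa [← hd])
    (by rwa [← hd, ← hM])
  rw [← hd, ← hM, hK] at hT
  have hT' : 2 * i * (n : ℝ) ^ 2 * Real.exp (-(d * ε ^ 2 / 16)) ≤ 2 * i * Real.exp (-L) := by
    rw [mul_assoc]
    refine mul_le_mul_of_nonneg_left ?_ (by positivity)
    rw [hN, ← Real.exp_nat_mul, ← Real.exp_add]
    refine Real.exp_le_exp.2 ?_
    have h2 := hpow (by norm_num : 2 ≤ 12)
    push_cast
    linarith only [h2, hεd, mul_le_mul_of_nonneg_right hL7 hL0.le, hL0]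
  set y := (1 - 2 * (δ / 16)) * Real.exp (-c) with hy
  have hy0 : 0 ≤ y := mul_nonneg (by linarith) hE1.le
  have hy1 : y ≤ Real.exp (-c) := mul_le_of_le_one_left hE1.le (by linarith)
  have hyl : 7 / 8 * Real.exp (-c) ≤ y := mul_le_mul_of_nonneg_right (by linarith) hE1.le
  have hS := gnpProb_separators_lt_le (n := n) (i := i) (ε := δ / 8) (θ := K * ε) (m := M) (y := y)
    h0 h1
    (by linarith) (by linarith) (by positivity)
    (by
      have h2 : ε * n ≤ δ / 8 * n := mul_le_mul_of_nonneg_right (by linarith) (by linarith)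
      have h3 : K * ε * M ≤ 1 * M := mul_le_mul_of_nonneg_right (by linarith) hM0
      linarith) hy0
    (fun a b ha hb => le_private_prob h0 (by linarith) (by linarith) hc0 hcm hmc' hη (by linarith)
      ha hb)
  have hS' : (n : ℝ) ^ 2 * Real.exp (-((1 - δ / 8) * n * y * (δ / 8) ^ 2 / 4)) ≤
      Real.exp (-L) := by
    have hnL : L ^ 4 ≤ n := by linarith [hpow (by norm_num : 4 ≤ 20)]
    have h2 := three_mul_le_of_le hδ0 hδ1 hδL hL7 hnL hE2 hyl
    rw [hN, ← Real.exp_nat_mul, ← Real.exp_add, ← hN]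
    refine Real.exp_le_exp.2 ?_
    push_cast
    linarith
  have hlow := le_common_pow hδ0 hδ1 hη hL0.le hr₀le
  have hny : 32 * (L ^ 3 + L) + 8 ≤ n * (1 - Real.exp (δ / 16 - c)) ^ r₀ := by
    refine hE.trans ?_
    calc Real.exp (δ / 2 * L) = n * Real.exp (-((1 - δ / 2) * L)) := by
          rw [hN, ← Real.exp_add]
          congr 1
          ring
      _ ≤ _ := mul_le_mul_of_nonneg_left hlow (by linarith)
  have hrθ : 4 * r₀ * (K * ε) * L ≤ δ / 16 := by
    have h2 : (r₀ : ℝ) * ((K * ε) * L) ≤ L ^ 2 * ((K * ε) * L) :=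
      mul_le_mul_of_nonneg_right hr₀L (by positivity)
    have h3 : L ^ 2 * ((K * ε) * L) = K * ε * L ^ 3 := by ring
    linarith
  have hrθ0 : 0 ≤ 4 * r₀ * (K * ε) := by positivity
  have hrθ1 : 4 * r₀ * (K * ε) ≤ 1 :=
    (le_mul_of_one_le_right hrθ0 hL1).trans (hrθ.trans (by linarith))
  have hR := gnpProb_resolves_le (n := n) (i := i) (r := r₀) (θ := K * ε) (m := M)
    (y := 1 - Real.exp (δ / 16 - c)) h0 h1 (by positivity)
    (by
      have h3 : (1 + K * ε) * M ≤ 2 * M := mul_le_mul_of_nonneg_right (by linarith) hM0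
      calc (r₀ : ℝ) * ((1 + K * ε) * M) ≤ L ^ 2 * (2 * M) :=
            mul_le_mul hr₀L h3 (by positivity) (by positivity)
        _ = 4 * M * L ^ 2 / 2 := by ring
        _ ≤ ε * n * L ^ 4 / 2 := by
            have := mul_le_mul h4M (hpow (by norm_num : 2 ≤ 4)) (by positivity) (by positivity)
            linarith
        _ = n / 2 := by rw [mul_right_comm, hεL, one_mul])
    (by linarith [exp_sub_le (by linarith) (by linarith) hη])
    (fun a ha => by
      have h2 := one_sub_pow_le_exp h1 a
      have h3 : Real.exp (-(p * a)) ≤ Real.exp (δ / 16 - c) := by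
        refine Real.exp_le_exp.2 ?_
        have h4 := mul_le_mul_of_nonneg_left ha h0
        have h5 : (1 - 4 * r₀ * (K * ε)) * c ≤ (1 - 4 * r₀ * (K * ε)) * (p * M) :=
          mul_le_mul_of_nonneg_left hcm (by linarith)
        have h6 : 4 * r₀ * (K * ε) * c ≤ 4 * r₀ * (K * ε) * L :=
          mul_le_mul_of_nonneg_left hcL hrθ0
        linarith
      linarith)
    (by
      have : 0 ≤ L ^ 3 := hL3.le
      linarith)
  have hR' : (n : ℝ) ^ r₀ * Real.exp (-(n * (1 - Real.exp (δ / 16 - c)) ^ r₀ / 32)) ≤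
      Real.exp (-L) := by
    have h2 : (n : ℝ) ^ r₀ = Real.exp (r₀ * L) := by rw [hN, ← Real.exp_nat_mul]
    rw [h2, ← Real.exp_add]
    refine Real.exp_le_exp.2 ?_
    have h3 : r₀ * L ≤ L ^ 2 * L := mul_le_mul_of_nonneg_right hr₀L hL0.le
    have h4 : L ^ 2 * L = L ^ 3 := by ring
    linarith
  obtain ⟨z, hz⟩ : ∃ z, z = 2 * ((1 - δ / 8) * ((1 - δ / 8) * y)) := ⟨_, rfl⟩
  have hzn : z * n = 2 * ((1 - δ / 8) * ((1 - δ / 8) * n * y)) := by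
    rw [hz]
    ring
  rw [← hzn] at hS
  have hzle : z ≤ 1 := by
    have h2 : (1 - δ / 8) * y ≤ y := mul_le_of_le_one_left hy0 (by linarith)
    have h3 : (1 - δ / 8) * ((1 - δ / 8) * y) ≤ (1 - δ / 8) * y :=
      mul_le_mul_of_nonneg_left h2 (by linarith)
    linarith
  have hzr : 2 * L < z * r₁ := by
    rw [hz]
    exact two_mul_lt_of_le hδ0 hδ1 hδL hL0 (by positivity) hE1 hE3 hexp hr₁lt hy
  have hpr : (n : ℝ) ^ 2 * (1 - z) ^ r₁ < 1 := by
    have h2 := one_sub_pow_le_exp hzle r₁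
    calc (n : ℝ) ^ 2 * (1 - z) ^ r₁ ≤ n ^ 2 * Real.exp (-(z * r₁)) :=
          mul_le_mul_of_nonneg_left h2 (by positivity)
      _ = Real.exp (2 * L - z * r₁) := by
          rw [hN, ← Real.exp_nat_mul, ← Real.exp_add]
          push_cast
          rw [sub_eq_add_neg]
      _ < 1 := by
          rw [Real.exp_lt_one_iff]
          linarith
  refine (gnpProb_mono h0 h1 ?_).trans ((gnpProb_not_metricDim_between_le h0 h1 hn
    (hT.trans hT') (hS.trans hS') (hR.trans hR') hrn hpr).trans (le_of_eq (by ring)))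
  rintro G hG ⟨hG1, hG2⟩
  refine hG ⟨?_, ?_⟩
  · exact (Nat.lt_of_floor_lt hG1).le
  · exact (Nat.cast_le.2 hG2).trans hr₁le

end FiniteBound

section Limits

variable {p c : ℕ → ℝ} {i : ℕ} {δ : ℝ}

theorem tendsto_gnpProb_one_of_subset (hp : ∀ n, 0 ≤ p n ∧ p n ≤ 1)
    {A B : ∀ n, Set (SimpleGraph (Fin n))} (hA : Tendsto (fun n => gnpProb n (p n) (A n))
      atTop (𝓝 1))
    (hAB : ∀ᶠ n in atTop, A n ⊆ B n) : Tendsto (fun n => gnpProb n (p n) (B n)) atTop (𝓝 1) := by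
  refine tendsto_of_tendsto_of_tendsto_of_le_of_le' hA tendsto_const_nhds ?_ ?_
  · filter_upwards [hAB] with n hn using gnpProb_mono (hp n).1 (hp n).2 hn
  · refine Eventually.of_forall fun n => ?_
    have h := gnpProb_nonneg (hp n).1 (hp n).2 (B n)ᶜ
    rw [gnpProb_compl] at h
    linarith

theorem tendsto_log_natCast_atTop : Tendsto (fun n : ℕ => Real.log n) atTop atTop :=
  Real.tendsto_log_atTop.comp tendsto_natCast_atTop_atTop

theorem eventually_log_pow_le (k : ℕ) : ∀ᶠ n : ℕ in atTop, Real.log n ^ k ≤ n := by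
  have h := (isLittleO_pow_log_id_atTop (n := k)).comp_tendsto tendsto_natCast_atTop_atTop
  filter_upwards [h.bound zero_lt_one, eventually_ge_atTop 1] with n hn h1
  simp only [Function.comp_apply, id_eq, one_mul, Real.norm_eq_abs, Nat.abs_cast] at hn
  exact (le_abs_self _).trans hn

theorem eventually_cubic_le_exp (hδ : 0 < δ) :
    ∀ᶠ x : ℝ in atTop, 32 * (x ^ 3 + x) + 8 ≤ Real.exp (δ * x) := by
  filter_upwards [(isLittleO_pow_exp_pos_mul_atTop (k := 4) hδ).bound zero_lt_one,
    eventually_ge_atTop 100] with x hx hx1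
  rw [one_mul, Real.norm_eq_abs, Real.norm_eq_abs, abs_of_nonneg (by positivity),
    abs_of_pos (Real.exp_pos _)] at hx
  have h2 : 100 * x ^ 3 ≤ x * x ^ 3 := mul_le_mul_of_nonneg_right hx1 (by positivity)
  have h3 : x ≤ x ^ 3 := le_self_pow₀ (by linarith) (by norm_num)
  linarith

theorem tendsto_gnpProb_metricDim_between (hp : ∀ n, 0 ≤ p n ∧ p n ≤ 1) (hi : 1 ≤ i)
    (hc : ∀ᶠ n : ℕ in atTop, (p n * ((n : ℝ) - 1)) ^ (i + 1) = c n * n)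
    (hc_inf : Tendsto c atTop atTop)
    (hec : ∀ᶠ n : ℕ in atTop, Real.exp (c n) ≤ Real.log n) (hδ0 : 0 < δ) (hδ1 : δ < 1) :
    Tendsto (fun n : ℕ => gnpProb n (p n) {G : SimpleGraph (Fin n) |
      (1 - δ) * (Real.exp (c n) * Real.log n) ≤ metricDim G ∧
        metricDim G ≤ (1 + δ) * (Real.exp (c n) * Real.log n)}) atTop (𝓝 1) := by
  have hlim : Tendsto (fun n : ℕ => 1 - (2 * i + 2) * Real.exp (-Real.log n)) atTop (𝓝 1) := by
    have h := ((Real.tendsto_exp_neg_atTop_nhds_zero.comp tendsto_log_natCast_atTop).const_mul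
      (2 * i + 2 : ℝ)).const_sub 1
    simpa using h
  have hη : ∀ᶠ n in atTop, Real.exp (-(c n / 2)) ≤ δ / 16 :=
    (Real.tendsto_exp_neg_atTop_nhds_zero.comp
      (hc_inf.atTop_div_const two_pos)).eventually_le_const (by positivity)
  refine tendsto_of_tendsto_of_tendsto_of_le_of_le' hlim tendsto_const_nhds ?_ ?_
  · filter_upwards [hc, hec, hη, eventually_ge_atTop 1, hc_inf.eventually_ge_atTop 1,
      tendsto_log_natCast_atTop.eventually (eventually_cubic_le_exp (half_pos hδ0)),
      eventually_log_pow_le (20 * (i + 1)),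
      (tendsto_log_natCast_atTop.const_mul_atTop hδ0).eventually_ge_atTop
        (1000 * (2 ^ (i + 2) + 3 * i))] with n hcn hecn hηn hn hc1 hE hlog hLB
    have hn1 : (1 : ℝ) ≤ n := by exact_mod_cast hn
    have hd0 : 0 ≤ p n * ((n : ℝ) - 1) := mul_nonneg (hp n).1 (by linarith)
    have hdL : Real.log n ^ 20 ≤ p n * (n - 1) := by
      refine le_of_pow_le_pow_left₀ (Nat.succ_ne_zero i) hd0 ?_
      rw [← pow_mul, Nat.succ_eq_add_one, hcn]
      exact hlog.trans (le_mul_of_one_le_left (by linarith) hc1)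
    have h := gnpProb_metricDim_not_mem_le (hp n).1 (hp n).2 hn hi rfl hδ0 hδ1 hLB hdL hcn
      (by linarith) hecn hηn hE
    rw [← Set.compl_ofPred, gnpProb_compl] at h
    linarith
  · refine Eventually.of_forall fun n => ?_
    have h := gnpProb_nonneg (hp n).1 (hp n).2 {G : SimpleGraph (Fin n) |
      (1 - δ) * (Real.exp (c n) * Real.log n) ≤ metricDim G ∧
        metricDim G ≤ (1 + δ) * (Real.exp (c n) * Real.log n)}ᶜ
    rw [gnpProb_compl] at h
    linarith

theorem abs_two_mul_div_log_sub_le {x L η : ℝ} (hx0 : 0 < x) (hx : x ≤ η / 2) (hη : η ≤ 1)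
    (hL : 0 ≤ L) :
    |2 * L / Real.log (1 / (x ^ 2 + (1 - x) ^ 2)) - x⁻¹ * L| ≤ η * (x⁻¹ * L) := by
  have hq0 : 0 < x ^ 2 + (1 - x) ^ 2 := by positivity
  have hq : x ^ 2 + (1 - x) ^ 2 = 1 - 2 * x * (1 - x) := by ring
  have hx1 : 0 < 1 - x := by linarith
  have hlo : 2 * x * (1 - x) ≤ Real.log (1 / (x ^ 2 + (1 - x) ^ 2)) := by
    rw [one_div, Real.log_inv]
    linarith [Real.log_le_sub_one_of_pos hq0]
  have hhi : Real.log (1 / (x ^ 2 + (1 - x) ^ 2)) ≤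
      2 * x * (1 - x) / (x ^ 2 + (1 - x) ^ 2) := by
    refine (Real.log_le_sub_one_of_pos (by positivity)).trans (le_of_eq ?_)
    field_simp
    ring
  have hu : 0 < 2 * x * (1 - x) := by positivity
  have hl0 := hu.trans_le hlo
  generalize Real.log (1 / (x ^ 2 + (1 - x) ^ 2)) = l at *
  have hg : 0 ≤ x⁻¹ * L := by positivity
  have hup : 2 * L / l ≤ (1 + η) * (x⁻¹ * L) := by
    rw [div_le_iff₀ hl0]
    have h1 : 1 ≤ (1 + η) * (1 - x) := by nlinarith
    calc 2 * L ≤ 2 * L * ((1 + η) * (1 - x)) := le_mul_of_one_le_right (by positivity) h1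
      _ = (1 + η) * (x⁻¹ * L) * (2 * x * (1 - x)) := by field_simp
      _ ≤ _ := mul_le_mul_of_nonneg_left hlo (mul_nonneg (by linarith) hg)
  have hdown : (1 - η) * (x⁻¹ * L) ≤ 2 * L / l := by
    rw [le_div_iff₀ hl0]
    have h1 : (1 - η) * (1 - x) ≤ x ^ 2 + (1 - x) ^ 2 := by nlinarith
    calc (1 - η) * (x⁻¹ * L) * l
        ≤ (1 - η) * (x⁻¹ * L) * (2 * x * (1 - x) / (x ^ 2 + (1 - x) ^ 2)) :=
          mul_le_mul_of_nonneg_left hhi (mul_nonneg (by linarith) hg)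
      _ = 2 * L * ((1 - η) * (1 - x) / (x ^ 2 + (1 - x) ^ 2)) := by field_simp
      _ ≤ 2 * L := mul_le_of_le_one_right (by positivity) ((div_le_one hq0).2 h1)
  rw [abs_le]
  constructor <;> linarith

theorem one_le_of_tendsto_pow_div_atTop {d : ℕ → ℝ} (hp : ∀ n, 0 ≤ p n ∧ p n ≤ 1)
    (hd : ∀ n, d n = p n * ((n : ℝ) - 1)) (hc : ∀ n : ℕ, c n = d n ^ (i + 1) / n)
    (hc_inf : Tendsto c atTop atTop) : 1 ≤ i := by
  by_contra h
  obtain rfl : i = 0 := by omega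
  obtain ⟨n, hn, hn1⟩ := ((hc_inf.eventually_gt_atTop 1).and (eventually_ge_atTop 1)).exists
  have hn1' : (1 : ℝ) ≤ n := by exact_mod_cast hn1
  rw [hc, zero_add, pow_one, hd, lt_div_iff₀ (by linarith), one_mul] at hn
  have := mul_le_of_le_one_left (sub_nonneg.2 hn1') (hp n).2
  linarith

theorem not_eventually_le_of_isLittleO {d : ℕ → ℝ} (hd : ∀ n, d n = p n * ((n : ℝ) - 1))
    (hi : 1 ≤ i) (ho : (fun n : ℕ => d n ^ i) =o[atTop] (fun n : ℕ => (n : ℝ))) {C : ℝ}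
    (hC : 0 < C) : ¬ ∀ᶠ n in atTop, C ≤ p n := by
  intro h
  obtain ⟨n, ⟨hn, hno⟩, hn1⟩ := ((h.and (ho.bound (show 0 < C / 4 by positivity))).and
    (tendsto_natCast_atTop_atTop.eventually_ge_atTop (2 + 2 / C))).exists
  have hn2 : 2 ≤ (n : ℝ) := by
    have : 0 < 2 / C := by positivity
    linarith
  have hCn : 2 ≤ C * n := by
    have h2 : C * (2 / C) ≤ C * n := mul_le_mul_of_nonneg_left (by linarith) hC.le
    rwa [mul_div_cancel₀ _ hC.ne'] at h2
  have hdn : C * n / 2 ≤ d n := by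
    rw [hd]
    have h2 := mul_le_mul_of_nonneg_right hn (by linarith : 0 ≤ (n : ℝ) - 1)
    have h3 := mul_le_mul_of_nonneg_left hn2 hC.le
    linarith
  have hdi : d n ≤ d n ^ i := le_self_pow₀ (by linarith) (by omega)
  rw [Real.norm_eq_abs, Real.norm_eq_abs, Nat.abs_cast] at hno
  linarith [le_abs_self (d n ^ i)]

end Limits

/-- Theorem 1.1(ii): if `c → ∞` and `e^c ≤ log n/(3 log log n)`, then a.a.s.
`β(G) = (1+o(1))·2·log n/log(1/q) = (1+o(1))·e^c·log n ≫ log n`. -/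
theorem stmt_1 (p d c q : ℕ → ℝ)
    (hp : ∀ n, 0 ≤ p n ∧ p n ≤ 1)
    (hd : ∀ n, d n = p n * ((n : ℝ) - 1))
    (hd_lower : Tendsto (fun n : ℕ => d n / (Real.log n) ^ 5) atTop atTop)
    (hd_upper : ∀ᶠ n : ℕ in atTop,
      d n ≤ (n : ℝ) * (1 - 3 * Real.log (Real.log n) / Real.log n))
    (i : ℕ)
    (hi : (fun n : ℕ => d n ^ i) =o[atTop] (fun n : ℕ => (n : ℝ)))
    (hi_max : ∀ j : ℕ, ((fun n : ℕ => d n ^ j) =o[atTop] (fun n : ℕ => (n : ℝ))) → j ≤ i)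
    (hc : ∀ n : ℕ, c n = d n ^ (i + 1) / n)
    (hq : (Tendsto p atTop (𝓝 0) ∧
            ∀ n, q n = Real.exp (-c n) ^ 2 + (1 - Real.exp (-c n)) ^ 2) ∨
          ((∃ C₁ C₂ : ℝ, 0 < C₁ ∧ ∀ᶠ n in atTop, C₁ ≤ p n ∧ p n ≤ C₂) ∧
            ∀ n, q n = p n ^ 2 + (1 - p n) ^ 2))
    (hc_inf : Tendsto c atTop atTop)
    (hec : ∀ᶠ n : ℕ in atTop,
      Real.exp (c n) ≤ Real.log n / (3 * Real.log (Real.log n))) :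
    (∀ δ : ℝ, 0 < δ →
      Tendsto (fun n : ℕ => gnpProb n (p n)
        {G : SimpleGraph (Fin n) |
          |(metricDim G : ℝ) - 2 * Real.log n / Real.log (1 / q n)| ≤
            δ * (2 * Real.log n / Real.log (1 / q n))}) atTop (𝓝 1)) ∧
    (∀ δ : ℝ, 0 < δ →
      Tendsto (fun n : ℕ => gnpProb n (p n)
        {G : SimpleGraph (Fin n) |
          |(metricDim G : ℝ) - Real.exp (c n) * Real.log n| ≤
            δ * (Real.exp (c n) * Real.log n)}) atTop (𝓝 1)) ∧
    (∀ K : ℝ, 0 < K →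
      Tendsto (fun n : ℕ => gnpProb n (p n)
        {G : SimpleGraph (Fin n) | K * Real.log n ≤ (metricDim G : ℝ)})
        atTop (𝓝 1)) := by
  have hi1 : 1 ≤ i := one_le_of_tendsto_pow_div_atTop hp hd hc hc_inf
  have hpow : ∀ᶠ n : ℕ in atTop, (p n * ((n : ℝ) - 1)) ^ (i + 1) = c n * n := by
    filter_upwards [eventually_ge_atTop 1] with n hn
    rw [hc, ← hd, div_mul_cancel₀]
    exact_mod_cast (by omega : n ≠ 0)
  have hlog1 : ∀ᶠ n : ℕ in atTop, 1 ≤ Real.log n :=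
    tendsto_log_natCast_atTop.eventually_ge_atTop 1
  have hec' : ∀ᶠ n : ℕ in atTop, Real.exp (c n) ≤ Real.log n := by
    filter_upwards [hec, hlog1, (Real.tendsto_log_atTop.comp
      tendsto_log_natCast_atTop).eventually_ge_atTop 1] with n hn h1 h2
    exact hn.trans (div_le_self (by linarith) (by simp only [Function.comp_apply] at h2; linarith))
  have hmain : ∀ δ : ℝ, 0 < δ → δ < 1 →
      Tendsto (fun n : ℕ => gnpProb n (p n) {G : SimpleGraph (Fin n) |
        (1 - δ) * (Real.exp (c n) * Real.log n) ≤ metricDim G ∧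
          metricDim G ≤ (1 + δ) * (Real.exp (c n) * Real.log n)}) atTop (𝓝 1) :=
    fun δ h0 h1 => tendsto_gnpProb_metricDim_between hp hi1 hpow hc_inf hec' h0 h1
  refine ⟨fun δ hδ => ?_, fun δ hδ => ?_, fun K hK => ?_⟩
  · obtain ⟨η, hη0, hη1, hηδ⟩ : ∃ η : ℝ, 0 < η ∧ η ≤ 1 / 4 ∧ 4 * η ≤ δ :=
      ⟨min δ 1 / 4, by positivity, by linarith [min_le_right δ 1], by linarith [min_le_left δ 1]⟩
    have hq' : ∀ n, q n = Real.exp (-c n) ^ 2 + (1 - Real.exp (-c n)) ^ 2 := by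
      rcases hq with h | ⟨⟨C₁, C₂, hC, h⟩, -⟩
      · exact h.2
      · exact absurd (h.mono fun n hn => hn.1) (not_eventually_le_of_isLittleO hd hi1 hi hC)
    have hx : ∀ᶠ n in atTop, Real.exp (-c n) ≤ η / 2 :=
      (Real.tendsto_exp_neg_atTop_nhds_zero.comp hc_inf).eventually_le_const (by positivity)
    refine tendsto_gnpProb_one_of_subset hp (hmain η hη0 (by linarith)) ?_
    filter_upwards [hx, hlog1] with n hxn h1
    have h2 := abs_two_mul_div_log_sub_le (Real.exp_pos _) hxn (by linarith)
      (zero_le_one.trans h1)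
    rw [← hq', Real.exp_neg, inv_inv, abs_le] at h2
    have hg : 0 ≤ Real.exp (c n) * Real.log n := mul_nonneg (Real.exp_pos _).le (by linarith)
    rintro G ⟨hG1, hG2⟩
    generalize Real.exp (c n) * Real.log n = g at *
    rw [Set.mem_ofPred_eq]
    generalize 2 * Real.log n / Real.log (1 / q n) = f at *
    have h3 : 3 / 4 * g ≤ f := by
      have := mul_le_mul_of_nonneg_right hη1 hg
      linarith
    have h4 : 2 * (η * g) ≤ δ * f := by
      calc 2 * (η * g) ≤ 4 * η * (3 / 4 * g) := by linarith [mul_nonneg hη0.le hg]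
        _ ≤ δ * f := mul_le_mul hηδ h3 (by linarith) hδ.le
    rw [abs_le]
    constructor <;> linarith
  · obtain ⟨η, hη0, hη1, hηδ⟩ : ∃ η : ℝ, 0 < η ∧ η < 1 ∧ η ≤ δ :=
      ⟨min δ 1 / 2, by positivity, by linarith [min_le_right δ 1],
        by linarith [min_le_left δ 1]⟩
    refine tendsto_gnpProb_one_of_subset hp (hmain η hη0 hη1) ?_
    filter_upwards [hlog1] with n h1
    rintro G ⟨hG1, hG2⟩
    have hg : 0 ≤ Real.exp (c n) * Real.log n := mul_nonneg (Real.exp_pos _).le (by linarith)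
    have h2 := mul_le_mul_of_nonneg_right hηδ hg
    rw [Set.mem_ofPred_eq, abs_le]
    constructor <;> linarith
  · refine tendsto_gnpProb_one_of_subset hp (hmain (1 / 2) (by norm_num) (by norm_num)) ?_
    filter_upwards [hlog1, (Real.tendsto_exp_atTop.comp hc_inf).eventually_ge_atTop (2 * K)]
      with n h1 hK2
    rintro G ⟨hG1, -⟩
    rw [Set.mem_ofPred_eq]
    have h2 := mul_le_mul_of_nonneg_right hK2 (zero_le_one.trans h1)
    simp only [Function.comp_apply] at h2
    linarith
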